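/- arXiv:2502.11324 — 2 statements merged into one kernel-verified Lean document; each statement's English description precedes it below -/
import Mathlib

section
/- Let X be an n × d matrix with i.i.d. N(μ, 1) entries (each row shifted by the mean vector μ ∈ R^d so each coordinate of each row is mean μ_j, variance 1), let μ̄ be the mean of the rows, and let Σ = (1/n)(X - μ̄)^T (X - μ̄) be the sample covariance matrix. Then for every t > 0, with probability at least 1 - 3*exp(-t^2/2), the spectral norm of Σ satisfies ||Σ||_2 ≤ (1 + sqrt(d/n) + t/sqrt(n) + sqrt(d + sqrt(2d)*t + t^2)/n)^2. -/
open MeasureTheory ProbabilityTheory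

/-- The law of a family of independent standard normal variables indexed by `κ`. -/
noncomputable abbrev stdNormalPi (κ : Type*) [Fintype κ] : Measure (κ → ℝ) :=
  Measure.pi fun _ => gaussianReal 0 1

lemma integrable_exp_mul_sum_abs {κ : Type*} [Fintype κ] (c : ℝ) :
    Integrable (fun z : κ → ℝ => Real.exp (c * ∑ k, |z k|)) (stdNormalPi κ) := by
  simp only [Finset.mul_sum, Real.exp_sum]
  exact Integrable.fintype_prod (f := fun _ x => Real.exp (c * |x|)) fun _ =>
    integrable_exp_mul_abs (integrable_exp_mul_gaussianReal c)
      (integrable_exp_mul_gaussianReal (-c))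

lemma integrable_of_abs_le_exp {κ : Type*} [Fintype κ] {G : (κ → ℝ) → ℝ} (hG : Measurable G)
    {C c : ℝ} (h : ∀ z, |G z| ≤ C * Real.exp (c * ∑ k, |z k|)) :
    Integrable G (stdNormalPi κ) :=
  ((integrable_exp_mul_sum_abs c).const_mul C).mono' hG.aestronglyMeasurable
    (Filter.Eventually.of_forall h)

/-- Stein's identity for the standard normal law. -/
lemma integral_id_mul_gaussianReal {f f' : ℝ → ℝ} (hf : ∀ x, HasDerivAt f (f' x) x)
    (h₀ : Integrable f (gaussianReal 0 1)) (h₁ : Integrable f' (gaussianReal 0 1))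
    (h₂ : Integrable (fun x => x * f x) (gaussianReal 0 1)) :
    ∫ x, x * f x ∂gaussianReal 0 1 = ∫ x, f' x ∂gaussianReal 0 1 := by
  have toVol : ∀ g : ℝ → ℝ, Integrable g (gaussianReal 0 1) →
      Integrable (fun x => g x * gaussianPDFReal 0 1 x) volume := by
    intro g hg
    rw [gaussianReal_of_var_ne_zero 0 one_ne_zero,
      integrable_withDensity_iff (measurable_gaussianPDF 0 1)
        (Filter.Eventually.of_forall fun _ => gaussianPDF_lt_top)] at hg
    simpa using hg
  have hφ : ∀ x, HasDerivAt (gaussianPDFReal 0 1) (-x * gaussianPDFReal 0 1 x) x := by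
    intro x
    have h : HasDerivAt (fun y : ℝ => -(y - 0) ^ 2 / (2 * ((1 : NNReal) : ℝ))) (-x) x := by
      have := (((hasDerivAt_id x).sub_const 0).pow 2).neg.div_const (2 * ((1 : NNReal) : ℝ))
      convert! this using 1
      simp
      ring
    have := h.exp.const_mul ((Real.sqrt (2 * Real.pi * (1 : NNReal)))⁻¹)
    convert! this using 1
    rw [gaussianPDFReal]; ring
  rw [integral_gaussianReal_eq_integral_smul one_ne_zero,
    integral_gaussianReal_eq_integral_smul one_ne_zero]
  have key := integral_mul_deriv_eq_deriv_mul_of_integrable (u := f) (v := gaussianPDFReal 0 1)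
    (u' := f') (v' := fun x => -x * gaussianPDFReal 0 1 x) (fun x _ => hf x) (fun x _ => hφ x)
    ?_ (toVol _ h₁) (toVol _ h₀)
  · have e1 : ∀ x, gaussianPDFReal 0 1 x • (x * f x)
        = -(f x * (-x * gaussianPDFReal 0 1 x)) := fun x => by simp only [smul_eq_mul]; ring
    have e2 : ∀ x, gaussianPDFReal 0 1 x • f' x = f' x * gaussianPDFReal 0 1 x :=
      fun x => by simp only [smul_eq_mul]; ring
    simp_rw [e1, e2]
    rw [integral_neg, key, neg_neg]
  · refine (toVol _ h₂).neg.congr (Filter.Eventually.of_forall fun x => ?_)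
    simp only [Pi.neg_apply, Pi.mul_apply]; ring

lemma measurePreserving_update {κ : Type*} [Fintype κ] [DecidableEq κ] (k : κ) :
    MeasurePreserving (fun q : (κ → ℝ) × ℝ => Function.update q.1 k q.2)
      ((stdNormalPi κ).prod (gaussianReal 0 1)) (stdNormalPi κ) := by
  have hm : Measurable (fun q : (κ → ℝ) × ℝ => Function.update q.1 k q.2) := by
    refine measurable_pi_lambda _ fun j => ?_
    by_cases h : j = k
    · subst h; simpa using measurable_snd
    · simp only [Function.update_of_ne h]; fun_prop
  refine ⟨hm, (Measure.pi_eq fun s hs => ?_).symm⟩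
  rw [Measure.map_apply hm (MeasurableSet.univ_pi hs)]
  have : (fun q : (κ → ℝ) × ℝ => Function.update q.1 k q.2) ⁻¹' Set.univ.pi s
      = (Set.univ.pi (Function.update s k Set.univ)) ×ˢ s k := by
    ext q
    simp only [Set.mem_preimage, Set.mem_pi, Set.mem_univ, true_imp_iff, Set.mem_prod]
    constructor
    · intro h
      refine ⟨fun j => ?_, by simpa using h k⟩
      by_cases hj : j = k
      · subst hj; simp
      · simpa [hj] using h j
    · rintro ⟨h, hk⟩ j
      by_cases hj : j = k
      · subst hj; simpa using hk
      · simpa [hj] using h j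
  rw [this, Measure.prod_prod, Measure.pi_pi, ← Finset.mul_prod_erase _ _ (Finset.mem_univ k),
    ← Finset.mul_prod_erase (Finset.univ) (fun i => gaussianReal 0 1 (s i)) (Finset.mem_univ k)]
  simp only [Function.update_self, measure_univ, one_mul]
  rw [mul_comm]
  congr 1
  refine Finset.prod_congr rfl fun j hj => ?_
  rw [Function.update_of_ne (Finset.ne_of_mem_erase hj)]

/-- Gaussian integration by parts in one coordinate. -/
lemma integral_eval_mul_stdNormalPi {κ : Type*} [Fintype κ] [DecidableEq κ] (k : κ)
    {f f' : (κ → ℝ) → ℝ}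
    (hf : ∀ z, HasDerivAt (fun x => f (Function.update z k x)) (f' z) (z k))
    (h₀ : Integrable f (stdNormalPi κ)) (h₁ : Integrable f' (stdNormalPi κ))
    (h₂ : Integrable (fun z => z k * f z) (stdNormalPi κ)) :
    ∫ z, z k * f z ∂stdNormalPi κ = ∫ z, f' z ∂stdNormalPi κ := by
  have hmp := measurePreserving_update k
  have slice : ∀ {g : (κ → ℝ) → ℝ}, Integrable g (stdNormalPi κ) →
      ∫ z, g z ∂stdNormalPi κ
        = ∫ z, ∫ x, g (Function.update z k x) ∂gaussianReal 0 1 ∂stdNormalPi κ := by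
    intro g hg
    rw [← integral_prod (fun q : (κ → ℝ) × ℝ => g (Function.update q.1 k q.2))
      (hmp.integrable_comp_of_integrable hg), ← hmp.map_eq, integral_map hmp.aemeasurable]
    · rw [hmp.map_eq]
    · rw [hmp.map_eq]; exact hg.aestronglyMeasurable
  rw [slice h₁, slice h₂]
  refine integral_congr_ae ?_
  filter_upwards [(hmp.integrable_comp_of_integrable h₀).prod_right_ae,
    (hmp.integrable_comp_of_integrable h₁).prod_right_ae,
    (hmp.integrable_comp_of_integrable h₂).prod_right_ae] with z i₀ i₁ i₂
  simp only [Function.comp_def, Function.update_self] at i₀ i₁ i₂ ⊢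
  refine integral_id_mul_gaussianReal (fun x => ?_) i₀ i₁ i₂
  simpa using hf (Function.update z k x)

/-- The `p`-th power of the sum of the exponentials of `β * w i`. -/
noncomputable def expSumPow {ι : Type*} [Fintype ι] (β p : ℝ) (w : ι → ℝ) : ℝ :=
  (∑ i, Real.exp (β * w i)) ^ p

/-- The `i`-th partial derivative of `expSumPow β p`. -/
noncomputable def expSumGrad {ι : Type*} [Fintype ι] (β p : ℝ) (w : ι → ℝ) (i : ι) : ℝ :=
  p * β * expSumPow β (p - 1) w * Real.exp (β * w i)

open Classical in
/-- The second partial derivatives of `expSumPow β p`. -/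
noncomputable def expSumHess {ι : Type*} [Fintype ι] (β p : ℝ) (w : ι → ℝ) (i j : ι) : ℝ :=
  p * β ^ 2 * ((p - 1) * expSumPow β (p - 2) w * Real.exp (β * w i) * Real.exp (β * w j)
    + if i = j then expSumPow β (p - 1) w * Real.exp (β * w i) else 0)

section ExpSum

variable {ι : Type*} [Fintype ι] {β p : ℝ}

lemma sum_exp_pos [Nonempty ι] (β : ℝ) (w : ι → ℝ) : 0 < ∑ i, Real.exp (β * w i) :=
  Finset.sum_pos (fun _ _ => Real.exp_pos _) Finset.univ_nonempty

lemma expSumPow_pos [Nonempty ι] (β p : ℝ) (w : ι → ℝ) : 0 < expSumPow β p w :=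
  Real.rpow_pos_of_pos (sum_exp_pos β w) p

lemma exp_le_sum_exp (β : ℝ) (w : ι → ℝ) (i : ι) :
    Real.exp (β * w i) ≤ ∑ i, Real.exp (β * w i) :=
  Finset.single_le_sum (f := fun i => Real.exp (β * w i)) (fun _ _ => (Real.exp_pos _).le)
    (Finset.mem_univ i)

lemma expSumPow_sub_one_mul_exp_le [Nonempty ι] (β p : ℝ) (w : ι → ℝ) (i : ι) :
    expSumPow β (p - 1) w * Real.exp (β * w i) ≤ expSumPow β p w := by
  calc expSumPow β (p - 1) w * Real.exp (β * w i)
      ≤ expSumPow β (p - 1) w * ∑ i, Real.exp (β * w i) :=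
        mul_le_mul_of_nonneg_left (exp_le_sum_exp β w i) (expSumPow_pos β _ w).le
    _ = expSumPow β p w := by
        rw [expSumPow, expSumPow, ← Real.rpow_add_one (sum_exp_pos β w).ne', sub_add_cancel]

lemma hasDerivAt_expSumPow [Nonempty ι] {w : ι → ℝ → ℝ} {w' : ι → ℝ} {x : ℝ}
    (h : ∀ i, HasDerivAt (w i) (w' i) x) :
    HasDerivAt (fun y => expSumPow β p fun i => w i y)
      (∑ i, expSumGrad β p (fun i => w i x) i * w' i) x := by
  have hs : HasDerivAt (fun y => ∑ i, Real.exp (β * w i y))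
      (∑ i, Real.exp (β * w i x) * (β * w' i)) x :=
    HasDerivAt.fun_sum fun i _ => ((h i).const_mul β).exp
  refine (hs.rpow_const (p := p) (Or.inl (sum_exp_pos β _).ne')).congr_deriv ?_
  rw [Finset.sum_mul, Finset.sum_mul]
  refine Finset.sum_congr rfl fun i _ => ?_
  simp only [expSumGrad, expSumPow]
  ring

lemma hasDerivAt_expSumGrad [Nonempty ι] {w : ι → ℝ → ℝ} {w' : ι → ℝ} {x : ℝ}
    (h : ∀ i, HasDerivAt (w i) (w' i) x) (i : ι) :
    HasDerivAt (fun y => expSumGrad β p (fun i => w i y) i)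
      (∑ j, expSumHess β p (fun i => w i x) i j * w' j) x := by
  refine (((hasDerivAt_expSumPow (β := β) (p := p - 1) h).const_mul (p * β)).mul
    ((h i).const_mul β).exp).congr_deriv ?_
  simp only [expSumHess, mul_add, add_mul, Finset.sum_add_distrib, mul_ite, ite_mul, mul_zero,
    zero_mul, Finset.mul_sum, Finset.sum_mul]
  congr 1
  · refine Finset.sum_congr rfl fun j _ => ?_
    rw [expSumGrad, show p - 1 - 1 = p - 2 by ring]
    ring
  · rw [Finset.sum_eq_single i (fun j _ hj => if_neg hj.symm) (by simp), if_pos rfl]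
    ring

lemma abs_expSumGrad_le [Nonempty ι] (hβ : 0 ≤ β) (hp : 0 ≤ p) (w : ι → ℝ) (i : ι) :
    |expSumGrad β p w i| ≤ p * β * expSumPow β p w := by
  have h0 := expSumPow_pos β (p - 1) w
  rw [expSumGrad, mul_assoc, abs_of_nonneg (by positivity)]
  exact mul_le_mul_of_nonneg_left (expSumPow_sub_one_mul_exp_le β p w i) (by positivity)

lemma abs_expSumHess_le [Nonempty ι] (hp : 0 ≤ p) (hp1 : p ≤ 1) (w : ι → ℝ) (i j : ι) :
    |expSumHess β p w i j| ≤ 2 * p * β ^ 2 * expSumPow β p w := by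
  have h0 := expSumPow_pos β p w
  have h1 := expSumPow_pos β (p - 1) w
  have h2 := expSumPow_pos β (p - 2) w
  have hi := Real.exp_pos (β * w i)
  have hj := Real.exp_pos (β * w j)
  have hG := expSumPow_sub_one_mul_exp_le β p w i
  have hG' := expSumPow_sub_one_mul_exp_le β p w j
  have hH : expSumPow β (p - 2) w * Real.exp (β * w i) * Real.exp (β * w j)
      ≤ expSumPow β p w := by
    have := expSumPow_sub_one_mul_exp_le β (p - 1) w i
    rw [show p - 1 - 1 = p - 2 by ring] at this
    exact (mul_le_mul_of_nonneg_right this hj.le).trans hG'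
  rw [expSumHess, abs_mul, abs_of_nonneg (by positivity : 0 ≤ p * β ^ 2),
    show 2 * p * β ^ 2 * expSumPow β p w
      = p * β ^ 2 * (expSumPow β p w + expSumPow β p w) by ring]
  refine mul_le_mul_of_nonneg_left ((abs_add_le _ _).trans (add_le_add ?_ ?_)) (by positivity)
  · rw [mul_assoc, mul_assoc, abs_mul, ← mul_assoc (expSumPow _ _ _),
      abs_of_nonneg (a := expSumPow β (p - 2) w * _ * _) (by positivity)]
    calc |p - 1| * (expSumPow β (p - 2) w * Real.exp (β * w i) * Real.exp (β * w j))
        ≤ 1 * expSumPow β p w :=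
          mul_le_mul (abs_le.2 ⟨by linarith, by linarith⟩) hH (by positivity) zero_le_one
      _ = expSumPow β p w := one_mul _
  · split_ifs
    · rwa [abs_of_nonneg (by positivity)]
    · simpa using h0.le

lemma expSumHess_nonpos_of_ne [Nonempty ι] (hp : 0 ≤ p) (hp1 : p ≤ 1) (w : ι → ℝ) {i j : ι}
    (hij : i ≠ j) : expSumHess β p w i j ≤ 0 := by
  have h2 := expSumPow_pos β (p - 2) w
  rw [expSumHess, if_neg hij, add_zero, mul_assoc (p - 1), mul_assoc (p - 1)]
  exact mul_nonpos_of_nonneg_of_nonpos (by positivity)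
    (mul_nonpos_of_nonpos_of_nonneg (by linarith) (by positivity))

@[fun_prop]
lemma measurable_expSumPow (β p : ℝ) : Measurable (expSumPow (ι := ι) β p) := by
  unfold expSumPow; fun_prop

@[fun_prop]
lemma measurable_expSumGrad (β p : ℝ) (i : ι) :
    Measurable fun w : ι → ℝ => expSumGrad β p w i := by
  unfold expSumGrad; fun_prop

@[fun_prop]
lemma measurable_expSumHess (β p : ℝ) (i j : ι) :
    Measurable fun w : ι → ℝ => expSumHess β p w i j := by
  unfold expSumHess
  split_ifs <;> fun_prop

lemma expSumPow_le [Nonempty ι] (hβ : 0 ≤ β) (hp : 0 ≤ p) {w : ι → ℝ} {m : ℝ}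
    (hw : ∀ i, w i ≤ m) :
    expSumPow β p w ≤ (Fintype.card ι : ℝ) ^ p * Real.exp (p * β * m) := by
  have h : ∑ i, Real.exp (β * w i) ≤ Fintype.card ι * Real.exp (β * m) := by
    calc ∑ i, Real.exp (β * w i) ≤ ∑ _i : ι, Real.exp (β * m) :=
          Finset.sum_le_sum fun i _ =>
            Real.exp_le_exp.2 (mul_le_mul_of_nonneg_left (hw i) hβ)
      _ = _ := by simp
  calc expSumPow β p w ≤ (Fintype.card ι * Real.exp (β * m)) ^ p :=
        Real.rpow_le_rpow (sum_exp_pos β w).le h hp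
    _ = _ := by
        rw [Real.mul_rpow (by positivity) (by positivity), ← Real.exp_mul]
        ring_nf

lemma exp_le_expSumPow (hp : 0 ≤ p) (w : ι → ℝ) (i : ι) :
    Real.exp (p * β * w i) ≤ expSumPow β p w := by
  calc Real.exp (p * β * w i) = Real.exp (β * w i) ^ p := by rw [← Real.exp_mul]; ring_nf
    _ ≤ _ := Real.rpow_le_rpow (Real.exp_pos _).le (exp_le_sum_exp β w i) hp

end ExpSum

section Comparison

variable {ι κ : Type*} [Fintype ι] [Fintype κ] {β p : ℝ}

lemma exists_forall_abs_le (c : ι → κ → ℝ) : ∃ K, 0 ≤ K ∧ ∀ i k, |c i k| ≤ K :=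
  ⟨∑ i, ∑ k, |c i k|, by positivity, fun i k =>
    (Finset.single_le_sum (f := fun k => |c i k|) (fun _ _ => abs_nonneg _)
      (Finset.mem_univ k)).trans
    (Finset.single_le_sum (f := fun i => ∑ k, |c i k|)
      (fun _ _ => Finset.sum_nonneg fun _ _ => abs_nonneg _) (Finset.mem_univ i))⟩

lemma measurable_linear {ι : Type*} (c : ι → κ → ℝ) :
    Measurable fun (z : κ → ℝ) i => ∑ k, c i k * z k := by
  fun_prop

lemma abs_sum_mul_le {c : κ → ℝ} {K : ℝ} (hc : ∀ k, |c k| ≤ K) (z : κ → ℝ) :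
    |∑ k, c k * z k| ≤ K * ∑ k, |z k| := by
  rw [Finset.mul_sum]
  refine (Finset.abs_sum_le_sum_abs _ _).trans (Finset.sum_le_sum fun k _ => ?_)
  rw [abs_mul]
  exact mul_le_mul_of_nonneg_right (hc k) (abs_nonneg _)

lemma expSumPow_linear_le [Nonempty ι] (hβ : 0 ≤ β) (hp : 0 ≤ p) {c : ι → κ → ℝ} {K : ℝ}
    (hc : ∀ i k, |c i k| ≤ K) (z : κ → ℝ) :
    expSumPow β p (fun i => ∑ k, c i k * z k)
      ≤ (Fintype.card ι : ℝ) ^ p * Real.exp (p * β * K * ∑ k, |z k|) := by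
  rw [mul_assoc (p * β)]
  exact expSumPow_le hβ hp fun i => (le_abs_self _).trans (abs_sum_mul_le (hc i) z)

lemma integrable_expSumPow_linear [Nonempty ι] (hβ : 0 ≤ β) (hp : 0 ≤ p) (c : ι → κ → ℝ) :
    Integrable (fun z => expSumPow β p fun i => ∑ k, c i k * z k) (stdNormalPi κ) := by
  obtain ⟨K, -, hK⟩ := exists_forall_abs_le c
  refine integrable_of_abs_le_exp (C := (Fintype.card ι : ℝ) ^ p) (c := p * β * K)
    (by fun_prop) fun z => ?_
  rw [abs_of_pos (expSumPow_pos β p _)]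
  exact expSumPow_linear_le hβ hp hK z

lemma abs_mul_exp_le {A B C K : ℝ} {z : κ → ℝ} (hB : 0 ≤ B) (hA : |A| ≤ B * ∑ k, |z k|)
    (G : ℝ) (hG : |G| ≤ C * Real.exp (K * ∑ k, |z k|)) :
    |A * G| ≤ B * C * Real.exp ((K + 1) * ∑ k, |z k|) := by
  have hx : ∑ k, |z k| ≤ Real.exp (∑ k, |z k|) := by
    have := Real.add_one_le_exp (∑ k, |z k|); linarith
  rw [abs_mul, add_mul, one_mul, Real.exp_add]
  calc |A| * |G| ≤ (B * Real.exp (∑ k, |z k|)) * (C * Real.exp (K * ∑ k, |z k|)) :=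
        mul_le_mul (hA.trans (mul_le_mul_of_nonneg_left hx hB)) hG (abs_nonneg _)
          (by positivity)
    _ = _ := by ring

lemma integral_expSumGrad_mul_linear [Nonempty ι] (hβ : 0 ≤ β) (hp : 0 ≤ p) (hp1 : p ≤ 1)
    (c e : ι → κ → ℝ) :
    ∫ z, ∑ i, expSumGrad β p (fun i => ∑ k, c i k * z k) i * ∑ k, e i k * z k ∂stdNormalPi κ
      = ∑ i, ∑ j, (∑ k, e i k * c j k) *
          ∫ z, expSumHess β p (fun i => ∑ k, c i k * z k) i j ∂stdNormalPi κ := by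
  classical
  obtain ⟨K, -, hK⟩ := exists_forall_abs_le c
  have bG : ∀ i (z : κ → ℝ), |expSumGrad β p (fun i => ∑ k, c i k * z k) i|
      ≤ p * β * (Fintype.card ι : ℝ) ^ p * Real.exp (p * β * K * ∑ k, |z k|) := fun i z => by
    rw [mul_assoc (p * β)]
    exact (abs_expSumGrad_le hβ hp _ i).trans
      (mul_le_mul_of_nonneg_left (expSumPow_linear_le hβ hp hK z) (by positivity))
  have iG : ∀ i, Integrable (fun z => expSumGrad β p (fun i => ∑ k, c i k * z k) i)
      (stdNormalPi κ) := fun i =>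
    integrable_of_abs_le_exp ((measurable_expSumGrad β p i).comp (by fun_prop)) (bG i)
  have iH : ∀ i j, Integrable (fun z => expSumHess β p (fun i => ∑ k, c i k * z k) i j)
      (stdNormalPi κ) := fun i j => by
    refine integrable_of_abs_le_exp ((measurable_expSumHess β p i j).comp (by fun_prop))
      (C := 2 * p * β ^ 2 * (Fintype.card ι : ℝ) ^ p) (c := p * β * K) fun z => ?_
    rw [mul_assoc (2 * p * β ^ 2)]
    exact (abs_expSumHess_le hp hp1 _ i j).trans
      (mul_le_mul_of_nonneg_left (expSumPow_linear_le hβ hp hK z) (by positivity))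
  have iZG : ∀ i k, Integrable (fun z => z k * expSumGrad β p (fun i => ∑ k, c i k * z k) i)
      (stdNormalPi κ) := fun i k =>
    integrable_of_abs_le_exp
      ((measurable_pi_apply k).mul ((measurable_expSumGrad β p i).comp (by fun_prop)))
      fun z => abs_mul_exp_le zero_le_one
        ((Finset.single_le_sum (f := fun k => |z k|) (fun _ _ => abs_nonneg _)
          (Finset.mem_univ k)).trans_eq (one_mul _).symm) _ (bG i z)
  have ibp : ∀ i k, ∫ z, z k * expSumGrad β p (fun i => ∑ k, c i k * z k) i ∂stdNormalPi κ
      = ∑ j, c j k * ∫ z, expSumHess β p (fun i => ∑ k, c i k * z k) i j ∂stdNormalPi κ := by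
    intro i k
    rw [integral_eval_mul_stdNormalPi k
      (f' := fun z => ∑ j, expSumHess β p (fun i => ∑ k, c i k * z k) i j * c j k) ?_ (iG i)
      (integrable_finsetSum _ fun j _ => (iH i j).mul_const _) (iZG i k),
      integral_finsetSum _ fun j _ => (iH i j).mul_const _]
    · exact Finset.sum_congr rfl fun j _ => by rw [integral_mul_const, mul_comm]
    · intro z
      have := hasDerivAt_expSumGrad (β := β) (p := p)
        (w := fun i x => ∑ l, c i l * Function.update z k x l) (w' := fun i => c i k)
        (x := z k) (fun j => ?_) i
      · simpa using this
      · have h : ∀ l, HasDerivAt (fun x => c j l * Function.update z k x l)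
            (if l = k then c j k else 0) (z k) := by
          intro l
          by_cases hl : l = k
          · subst hl
            simpa using (hasDerivAt_id (z l)).const_mul (c j l)
          · simpa [hl] using hasDerivAt_const (z k) (c j l * z l)
        simpa using HasDerivAt.fun_sum (u := Finset.univ) fun l _ => h l
  have expand : ∀ z : κ → ℝ,
      ∑ i, expSumGrad β p (fun i => ∑ k, c i k * z k) i * ∑ k, e i k * z k
      = ∑ i, ∑ k, e i k * (z k * expSumGrad β p (fun i => ∑ k, c i k * z k) i) := fun z =>
    Finset.sum_congr rfl fun i _ => by
      rw [Finset.mul_sum]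
      exact Finset.sum_congr rfl fun k _ => by ring
  simp_rw [expand]
  rw [integral_finsetSum _ fun i _ => integrable_finsetSum _ fun k _ => (iZG i k).const_mul _]
  refine Finset.sum_congr rfl fun i _ => ?_
  rw [integral_finsetSum _ fun k _ => (iZG i k).const_mul _]
  simp_rw [integral_const_mul, ibp, Finset.mul_sum, Finset.sum_mul]
  rw [Finset.sum_comm]
  exact Finset.sum_congr rfl fun j _ => Finset.sum_congr rfl fun k _ => by ring

lemma hasDerivAt_integral_expSumPow_linear [Nonempty ι] (hβ : 0 ≤ β) (hp : 0 ≤ p)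
    {c e : ℝ → ι → κ → ℝ} {K : ℝ} (hK : 0 ≤ K) (bc : ∀ θ i k, |c θ i k| ≤ K)
    (be : ∀ θ i k, |e θ i k| ≤ K) (hce : ∀ θ i k, HasDerivAt (fun θ => c θ i k) (e θ i k) θ)
    (θ : ℝ) :
    HasDerivAt (fun θ => ∫ z, expSumPow β p (fun i => ∑ k, c θ i k * z k) ∂stdNormalPi κ)
      (∫ z, ∑ i, expSumGrad β p (fun i => ∑ k, c θ i k * z k) i *
        ∑ k, e θ i k * z k ∂stdNormalPi κ) θ := by
  have hmeas : ∀ θ, AEStronglyMeasurable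
      (fun z => expSumPow β p (fun i => ∑ k, c θ i k * z k)) (stdNormalPi κ) := fun θ =>
    ((measurable_expSumPow β p).comp (measurable_linear (c θ))).aestronglyMeasurable
  have hmeas' : AEStronglyMeasurable
      (fun z => ∑ i, expSumGrad β p (fun i => ∑ k, c θ i k * z k) i * ∑ k, e θ i k * z k)
      (stdNormalPi κ) :=
    (Finset.measurable_sum _ fun i _ =>
      ((measurable_expSumGrad β p i).comp (measurable_linear (c θ))).mul
        ((measurable_pi_apply i).comp (measurable_linear (e θ)))).aestronglyMeasurable
  have hbound : ∀ (z : κ → ℝ) θ,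
      ‖∑ i, expSumGrad β p (fun i => ∑ k, c θ i k * z k) i * ∑ k, e θ i k * z k‖
        ≤ ∑ _i : ι, K * (p * β * (Fintype.card ι : ℝ) ^ p) *
          Real.exp ((p * β * K + 1) * ∑ k, |z k|) := by
    intro z θ
    rw [Real.norm_eq_abs]
    refine (Finset.abs_sum_le_sum_abs _ _).trans (Finset.sum_le_sum fun i _ => ?_)
    rw [mul_comm (expSumGrad _ _ _ _)]
    have hG : |expSumGrad β p (fun i => ∑ k, c θ i k * z k) i|
        ≤ p * β * (Fintype.card ι : ℝ) ^ p * Real.exp (p * β * K * ∑ k, |z k|) := by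
      rw [mul_assoc (p * β)]
      exact (abs_expSumGrad_le hβ hp _ i).trans
        (mul_le_mul_of_nonneg_left (expSumPow_linear_le hβ hp (bc θ) z) (by positivity))
    exact abs_mul_exp_le hK (abs_sum_mul_le (be θ i) z) _ hG
  have hdiff : ∀ (z : κ → ℝ) θ,
      HasDerivAt (fun θ => expSumPow β p (fun i => ∑ k, c θ i k * z k))
        (∑ i, expSumGrad β p (fun i => ∑ k, c θ i k * z k) i * ∑ k, e θ i k * z k) θ :=
    fun z θ => hasDerivAt_expSumPow fun i => HasDerivAt.fun_sum fun k _ =>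
      (hce θ i k).mul_const _
  exact (hasDerivAt_integral_of_dominated_loc_of_deriv_le Filter.univ_mem
    (Filter.Eventually.of_forall hmeas) (integrable_expSumPow_linear hβ hp (c θ)) hmeas'
    (Filter.Eventually.of_forall fun z θ _ => hbound z θ)
    (integrable_finsetSum _ fun i _ => (integrable_exp_mul_sum_abs _).const_mul _)
    (Filter.Eventually.of_forall fun z θ _ => hdiff z θ)).2

/-- A Slepian-type comparison for Gaussian families with equal variances, in exponential form. -/
theorem integral_expSumPow_le_of_covariance_le [Nonempty ι] (hβ : 0 ≤ β) (hp : 0 ≤ p)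
    (hp1 : p ≤ 1) {a b : ι → κ → ℝ} (orth : ∀ i j, ∑ k, a i k * b j k = 0)
    (hvar : ∀ i, ∑ k, a i k * a i k = ∑ k, b i k * b i k)
    (hcov : ∀ i j, ∑ k, b i k * b j k ≤ ∑ k, a i k * a j k) :
    ∫ z, expSumPow β p (fun i => ∑ k, a i k * z k) ∂stdNormalPi κ
      ≤ ∫ z, expSumPow β p (fun i => ∑ k, b i k * z k) ∂stdNormalPi κ := by
  set c : ℝ → ι → κ → ℝ := fun θ i k => Real.cos θ * b i k + Real.sin θ * a i k with hc
  set e : ℝ → ι → κ → ℝ := fun θ i k => -Real.sin θ * b i k + Real.cos θ * a i k with he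
  set Φ : ℝ → ℝ := fun θ => ∫ z, expSumPow β p (fun i => ∑ k, c θ i k * z k) ∂stdNormalPi κ
    with hΦ
  obtain ⟨A, hA0, hA⟩ := exists_forall_abs_le a
  obtain ⟨B, hB0, hB⟩ := exists_forall_abs_le b
  have bound : ∀ {x y : ℝ}, |x| ≤ 1 → |y| ≤ 1 → ∀ i k, |x * b i k + y * a i k| ≤ B + A := by
    intro x y hx hy i k
    refine (abs_add_le _ _).trans (add_le_add ?_ ?_) <;> rw [abs_mul]
    · exact (mul_le_of_le_one_left (abs_nonneg _) hx).trans (hB i k)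
    · exact (mul_le_of_le_one_left (abs_nonneg _) hy).trans (hA i k)
  have bc : ∀ θ i k, |c θ i k| ≤ B + A := fun θ =>
    bound (Real.abs_cos_le_one θ) (Real.abs_sin_le_one θ)
  have be : ∀ θ i k, |e θ i k| ≤ B + A := fun θ =>
    bound (by rw [abs_neg]; exact Real.abs_sin_le_one θ) (Real.abs_cos_le_one θ)
  have hcov' : ∀ θ i j, ∑ k, e θ i k * c θ j k = Real.sin θ * Real.cos θ *
      (∑ k, a i k * a j k - ∑ k, b i k * b j k) := by
    intro θ i j
    have h : ∀ k, e θ i k * c θ j k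
        = Real.sin θ * Real.cos θ * (a i k * a j k) - Real.sin θ * Real.cos θ * (b i k * b j k)
          + (Real.cos θ ^ 2 * (a i k * b j k) - Real.sin θ ^ 2 * (a j k * b i k)) := fun k => by
      simp only [hc, he]; ring
    simp_rw [h, Finset.sum_add_distrib, Finset.sum_sub_distrib, ← Finset.mul_sum, orth]
    ring
  have hderiv := hasDerivAt_integral_expSumPow_linear hβ hp (add_nonneg hB0 hA0) bc be
    fun θ i k => ((Real.hasDerivAt_cos θ).mul_const (b i k)).add
      ((Real.hasDerivAt_sin θ).mul_const (a i k))
  have hanti : AntitoneOn Φ (Set.Icc 0 (Real.pi / 2)) := by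
    refine antitoneOn_of_deriv_nonpos (convex_Icc _ _)
      (fun θ _ => (hderiv θ).continuousAt.continuousWithinAt)
      (fun θ _ => (hderiv θ).differentiableAt.differentiableWithinAt) fun θ hθ => ?_
    rw [interior_Icc] at hθ
    rw [(hderiv θ).deriv, integral_expSumGrad_mul_linear hβ hp hp1]
    refine Finset.sum_nonpos fun i _ => Finset.sum_nonpos fun j _ => ?_
    rw [hcov']
    by_cases hij : i = j
    · subst hij
      rw [hvar, sub_self, mul_zero, zero_mul]
    · refine mul_nonpos_of_nonneg_of_nonpos (mul_nonneg (mul_nonneg ?_ ?_) ?_)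
        (integral_nonpos fun z => expSumHess_nonpos_of_ne hp hp1 _ hij)
      · exact Real.sin_nonneg_of_nonneg_of_le_pi hθ.1.le (by linarith [hθ.2, Real.pi_pos])
      · exact Real.cos_nonneg_of_neg_pi_div_two_le_of_le
          (by linarith [hθ.1, Real.pi_pos]) hθ.2.le
      · exact sub_nonneg.2 (hcov i j)
  have h := hanti (Set.left_mem_Icc.2 (by positivity)) (Set.right_mem_Icc.2 (by positivity))
    (by positivity : (0 : ℝ) ≤ Real.pi / 2)
  simpa [hΦ, hc] using h

end Comparison

section ChiMoment

lemma integral_exp_sq_gaussianReal {y : ℝ} (hy : 0 < y) :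
    Integrable (fun x => Real.exp ((1 - 1 / y ^ 2) / 2 * x ^ 2)) (gaussianReal 0 1) ∧
      ∫ x, Real.exp ((1 - 1 / y ^ 2) / 2 * x ^ 2) ∂gaussianReal 0 1 = y := by
  have hb : 0 < 1 / (2 * y ^ 2) := by positivity
  have e : ∀ x : ℝ, gaussianPDFReal 0 1 x * Real.exp ((1 - 1 / y ^ 2) / 2 * x ^ 2)
      = (Real.sqrt (2 * Real.pi))⁻¹ * Real.exp (-(1 / (2 * y ^ 2)) * x ^ 2) := by
    intro x
    rw [gaussianPDFReal, mul_assoc, ← Real.exp_add]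
    congr 2
    · simp
    · simp only [NNReal.coe_one]
      field_simp
      ring
  constructor
  · rw [gaussianReal_of_var_ne_zero 0 one_ne_zero,
      integrable_withDensity_iff (measurable_gaussianPDF 0 1)
        (Filter.Eventually.of_forall fun _ => gaussianPDF_lt_top)]
    refine ((integrable_exp_neg_mul_sq hb).const_mul (Real.sqrt (2 * Real.pi))⁻¹).congr
      (Filter.Eventually.of_forall fun x => ?_)
    simp only [toReal_gaussianPDF]
    rw [← e, mul_comm]
  · rw [integral_gaussianReal_eq_integral_smul one_ne_zero]
    simp_rw [smul_eq_mul, e]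
    rw [integral_const_mul, integral_gaussian,
      show Real.pi / (1 / (2 * y ^ 2)) = 2 * Real.pi * y ^ 2 by field_simp,
      Real.sqrt_mul (by positivity) (y ^ 2), Real.sqrt_sq hy.le,
      inv_mul_cancel_left₀ (by positivity)]

lemma log_le_half_sub_inv {y : ℝ} (hy : 1 ≤ y) : Real.log y ≤ (y - 1 / y) / 2 := by
  have h := Real.self_le_sinh_iff.2 (Real.log_nonneg hy)
  rwa [Real.sinh_eq, Real.exp_neg, Real.exp_log (by linarith), ← one_div] at h

/-- The norm of a standard normal vector has the moment generating function of a
sub-Gaussian variable centred at the square root of the dimension. -/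
lemma integral_exp_mul_sqrt_sum_sq_le {κ : Type*} [Fintype κ] [Nonempty κ] {l : ℝ}
    (hl : 0 ≤ l) :
    Integrable (fun z : κ → ℝ => Real.exp (l * Real.sqrt (∑ k, z k ^ 2))) (stdNormalPi κ) ∧
      ∫ z, Real.exp (l * Real.sqrt (∑ k, z k ^ 2)) ∂stdNormalPi κ
        ≤ Real.exp (l * Real.sqrt (Fintype.card κ) + l ^ 2 / 2) := by
  set m : ℝ := (Fintype.card κ : ℝ) with hm
  have hm0 : 0 < m := by simpa [hm] using Fintype.card_pos (α := κ)
  set s := Real.sqrt m with hs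
  have hs0 : 0 < s := Real.sqrt_pos.2 hm0
  have hss : s ^ 2 = m := Real.sq_sqrt hm0.le
  obtain ⟨y, hy1, hy⟩ : ∃ y : ℝ, 1 ≤ y ∧ l = s * (y - 1 / y) := by
    set x := l / s with hx
    have hx0 : 0 ≤ x := by positivity
    have hr := Real.sq_sqrt (by positivity : 0 ≤ x ^ 2 + 4)
    have hr2 : 2 ≤ Real.sqrt (x ^ 2 + 4) := Real.le_sqrt_of_sq_le (by nlinarith)
    have hy0 : 0 < (x + Real.sqrt (x ^ 2 + 4)) / 2 := by linarith
    refine ⟨(x + Real.sqrt (x ^ 2 + 4)) / 2, by linarith, ?_⟩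
    have : x = (x + Real.sqrt (x ^ 2 + 4)) / 2 - 1 / ((x + Real.sqrt (x ^ 2 + 4)) / 2) := by
      rw [eq_sub_iff_add_eq', ← eq_sub_iff_add_eq, div_eq_iff hy0.ne']
      nlinarith
    rw [← this, hx]
    field_simp
  have hy0 : 0 < y := by linarith
  obtain ⟨hInt, hval⟩ := integral_exp_sq_gaussianReal hy0
  have dom : ∀ z : κ → ℝ, Real.exp (l * Real.sqrt (∑ k, z k ^ 2))
      ≤ Real.exp (m * (y ^ 2 - 1) / 2) * ∏ k, Real.exp ((1 - 1 / y ^ 2) / 2 * z k ^ 2) := by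
    intro z
    rw [← Real.exp_sum, ← Real.exp_add, ← Finset.mul_sum]
    refine Real.exp_le_exp.2 ?_
    set R := ∑ k, z k ^ 2 with hR
    have hR0 : 0 ≤ R := Finset.sum_nonneg fun _ _ => sq_nonneg _
    have hRs := Real.sq_sqrt hR0
    have hfac : m * (y ^ 2 - 1) / 2 + (1 - 1 / y ^ 2) / 2 * R - l * Real.sqrt R
        = (1 - 1 / y ^ 2) / 2 * (s * y - Real.sqrt R) ^ 2 := by
      rw [hy, ← hss]
      nth_rewrite 1 [← hRs]
      field_simp
      ring
    have : 0 ≤ (1 - 1 / y ^ 2) / 2 * (s * y - Real.sqrt R) ^ 2 := by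
      have : 1 / y ^ 2 ≤ 1 := by
        rw [div_le_one (by positivity)]; nlinarith
      have : 0 ≤ 1 - 1 / y ^ 2 := by linarith
      positivity
    linarith
  have hdom : Integrable (fun z : κ → ℝ => Real.exp (m * (y ^ 2 - 1) / 2) *
      ∏ k, Real.exp ((1 - 1 / y ^ 2) / 2 * z k ^ 2)) (stdNormalPi κ) :=
    (Integrable.fintype_prod (f := fun _ x => Real.exp ((1 - 1 / y ^ 2) / 2 * x ^ 2))
      fun _ => hInt).const_mul _
  have hI : Integrable (fun z : κ → ℝ => Real.exp (l * Real.sqrt (∑ k, z k ^ 2)))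
      (stdNormalPi κ) := by
    refine hdom.mono' (Measurable.aestronglyMeasurable (by fun_prop)) (Filter.Eventually.of_forall fun z => ?_)
    rw [Real.norm_eq_abs, abs_of_pos (Real.exp_pos _)]
    exact dom z
  refine ⟨hI, (integral_mono hI hdom dom).trans ?_⟩
  rw [integral_const_mul, integral_fintype_prod_eq_prod
    (f := fun (_ : κ) x => Real.exp ((1 - 1 / y ^ 2) / 2 * x ^ 2)), hval, Finset.prod_const,
    Finset.card_univ, ← Real.exp_log (pow_pos hy0 (Fintype.card κ)), ← Real.exp_add, Real.log_pow]
  refine Real.exp_le_exp.2 ?_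
  rw [← hm, hy, show s * (y - 1 / y) * s + (s * (y - 1 / y)) ^ 2 / 2
    = m * ((y - 1 / y) + (y - 1 / y) ^ 2 / 2) by rw [← hss]; ring, mul_div_assoc, ← mul_add]
  refine mul_le_mul_of_nonneg_left ?_ hm0.le
  have hlog := log_le_half_sub_inv hy1
  have hfac : (y - 1 / y) + (y - 1 / y) ^ 2 / 2 - ((y ^ 2 - 1) / 2 + (y - 1 / y) / 2)
      = (y - 1) ^ 2 * (y + 1) / (2 * y ^ 2) := by
    field_simp
    ring
  have : 0 ≤ (y - 1) ^ 2 * (y + 1) / (2 * y ^ 2) := by positivity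
  linarith

end ChiMoment

section Chevet

lemma integral_stdNormalPi_sum_mul {ι κ : Type*} [Fintype ι] [Fintype κ]
    (f : (ι → ℝ) → ℝ) (g : (κ → ℝ) → ℝ) :
    ∫ z : ι ⊕ κ → ℝ, f (fun i => z (Sum.inl i)) * g (fun k => z (Sum.inr k)) ∂stdNormalPi (ι ⊕ κ)
      = (∫ z, f z ∂stdNormalPi ι) * ∫ z, g z ∂stdNormalPi κ := by
  rw [← integral_prod_mul f g]
  exact (measurePreserving_sumPiEquivProdPi (X := fun _ : ι ⊕ κ => ℝ)
    fun _ => gaussianReal 0 1).integral_comp' (fun q => f q.1 * g q.2)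

lemma Integrable.stdNormalPi_sum_mul {ι κ : Type*} [Fintype ι] [Fintype κ]
    {f : (ι → ℝ) → ℝ} {g : (κ → ℝ) → ℝ} (hf : Integrable f (stdNormalPi ι))
    (hg : Integrable g (stdNormalPi κ)) :
    Integrable (fun z : ι ⊕ κ → ℝ => f (fun i => z (Sum.inl i)) * g (fun k => z (Sum.inr k)))
      (stdNormalPi (ι ⊕ κ)) :=
  (measurePreserving_sumPiEquivProdPi (X := fun _ : ι ⊕ κ => ℝ)
    fun _ => gaussianReal 0 1).integrable_comp_of_integrable (hf.mul_prod hg)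

variable {ι m n : Type*} [Fintype ι] [Fintype m] [Fintype n]

lemma sum_mul_le_one {a b : m → ℝ} (ha : ∑ i, a i ^ 2 = 1) (hb : ∑ i, b i ^ 2 = 1) :
    ∑ i, a i * b i ≤ 1 := by
  have : ∑ i, a i * b i ≤ ∑ i, (a i ^ 2 + b i ^ 2) / 2 :=
    Finset.sum_le_sum fun i _ => by nlinarith [sq_nonneg (a i - b i)]
  rw [← Finset.sum_div, Finset.sum_add_distrib, ha, hb] at this
  linarith

lemma sum_mul_le_sqrt {a : m → ℝ} (ha : ∑ i, a i ^ 2 = 1) (b : m → ℝ) :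
    ∑ i, a i * b i ≤ Real.sqrt (∑ i, b i ^ 2) := by
  have := Real.sum_mul_le_sqrt_mul_sqrt Finset.univ a b
  rwa [ha, Real.sqrt_one, one_mul] at this

/-- An exponential form of Chevet's inequality for the bilinear forms of a Gaussian matrix. -/
theorem integral_expSumPow_bilinear_le [Nonempty ι] [Nonempty m] [Nonempty n] {β p : ℝ}
    (hβ : 0 ≤ β) (hp : 0 ≤ p) (hp1 : p ≤ 1) {v : ι → n → ℝ} {u : ι → m → ℝ}
    (hv : ∀ i, ∑ k, v i k ^ 2 = 1) (hu : ∀ i, ∑ k, u i k ^ 2 = 1) :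
    ∫ z, expSumPow β p (fun i => ∑ q : n × m, v i q.1 * u i q.2 * z q) ∂stdNormalPi (n × m)
      ≤ (Fintype.card ι : ℝ) ^ p * Real.exp (p * β *
          (Real.sqrt (Fintype.card n) + Real.sqrt (Fintype.card m)) + (p * β) ^ 2 / 2) := by
  set a : ι → ((n × m) ⊕ Unit) ⊕ (m ⊕ n) → ℝ := fun i =>
    Sum.elim (Sum.elim (fun q => v i q.1 * u i q.2) fun _ => 1) 0 with ha
  set b : ι → ((n × m) ⊕ Unit) ⊕ (m ⊕ n) → ℝ := fun i =>
    Sum.elim 0 (Sum.elim (u i) (v i)) with hb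
  have hprod : ∀ i j, ∑ q : n × m, v i q.1 * u i q.2 * (v j q.1 * u j q.2)
      = (∑ k, v i k * v j k) * ∑ k, u i k * u j k := by
    intro i j
    rw [Fintype.sum_prod_type, Finset.sum_mul_sum]
    exact Finset.sum_congr rfl fun _ _ => Finset.sum_congr rfl fun _ _ => by ring
  have cmp := integral_expSumPow_le_of_covariance_le hβ hp hp1 (a := a) (b := b)
    (fun i j => by simp [ha, hb, Fintype.sum_sum_type])
    (fun i => by
      simp only [ha, hb, Fintype.sum_sum_type, Sum.elim_inl, Sum.elim_inr, hprod]
      simp [← pow_two, hu, hv])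
    (fun i j => by
      simp only [ha, hb, Fintype.sum_sum_type, Sum.elim_inl, Sum.elim_inr, hprod]
      simp only [Pi.zero_apply, mul_zero, Finset.sum_const_zero, zero_add, add_zero,
        Finset.sum_const, Finset.card_univ, Fintype.card_unit, one_smul, mul_one]
      nlinarith [sum_mul_le_one (hu i) (hu j), sum_mul_le_one (hv i) (hv j)])
  have hl : 0 ≤ p * β := by positivity
  have left : ∫ z, expSumPow β p (fun i => ∑ k, a i k * z k)
        ∂stdNormalPi (((n × m) ⊕ Unit) ⊕ (m ⊕ n))
      = (∫ z, expSumPow β p (fun i => ∑ q : n × m, v i q.1 * u i q.2 * z q)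
        ∂stdNormalPi (n × m)) * Real.exp ((p * β) ^ 2 / 2) := by
    have hg : ∫ z : Unit → ℝ, Real.exp (p * β * z ()) ∂stdNormalPi Unit
        = Real.exp ((p * β) ^ 2 / 2) := by
      have h := integral_fintype_prod_eq_prod (ι := Unit) (𝕜 := ℝ)
        (f := fun _ x => Real.exp (p * β * x)) (μ := fun _ => gaussianReal 0 1)
      have hmgf := congrFun (mgf_id_gaussianReal (μ := 0) (v := 1)) (p * β)
      simp only [mgf, id] at hmgf
      simp only [Finset.univ_unique, Finset.prod_singleton, PUnit.default_eq_unit] at h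
      rw [h, hmgf]
      simp
    have h2 := integral_stdNormalPi_sum_mul (ι := n × m) (κ := Unit)
      (fun z => expSumPow β p (fun i => ∑ q : n × m, v i q.1 * u i q.2 * z q))
      (fun z => Real.exp (p * β * z ()))
    have h1 := integral_stdNormalPi_sum_mul (ι := (n × m) ⊕ Unit) (κ := m ⊕ n)
      (fun z => expSumPow β p (fun i => ∑ q : n × m, v i q.1 * u i q.2 * z (Sum.inl q)) *
        Real.exp (p * β * z (Sum.inr ()))) (fun _ => 1)
    rw [← hg, ← h2]
    simp only [integral_const, probReal_univ, smul_eq_mul, mul_one] at h1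
    rw [← h1]
    congr 1
    ext z
    simp only [ha, Fintype.sum_sum_type, Sum.elim_inl, Sum.elim_inr, expSumPow]
    simp only [Pi.zero_apply, zero_mul, Finset.sum_const_zero, add_zero, Finset.univ_unique,
      Finset.sum_singleton, PUnit.default_eq_unit, one_mul, mul_add, Real.exp_add]
    rw [← Finset.sum_mul, Real.mul_rpow (by positivity) (by positivity), ← Real.exp_mul]
    ring_nf
  obtain ⟨im, bm⟩ := integral_exp_mul_sqrt_sum_sq_le (κ := m) hl
  obtain ⟨iN, bn⟩ := integral_exp_mul_sqrt_sum_sq_le (κ := n) hl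
  have right : ∫ z, expSumPow β p (fun i => ∑ k, b i k * z k)
        ∂stdNormalPi (((n × m) ⊕ Unit) ⊕ (m ⊕ n))
      ≤ (Fintype.card ι : ℝ) ^ p *
        (Real.exp (p * β * Real.sqrt (Fintype.card m) + (p * β) ^ 2 / 2) *
          Real.exp (p * β * Real.sqrt (Fintype.card n) + (p * β) ^ 2 / 2)) := by
    have h2 := integral_stdNormalPi_sum_mul (ι := m) (κ := n)
      (fun z => Real.exp (p * β * Real.sqrt (∑ k, z k ^ 2)))
      (fun z => Real.exp (p * β * Real.sqrt (∑ k, z k ^ 2)))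
    have i2 := Integrable.stdNormalPi_sum_mul im iN
    have h1 := integral_stdNormalPi_sum_mul (ι := (n × m) ⊕ Unit) (κ := m ⊕ n) (fun _ => 1)
      (fun z => Real.exp (p * β * Real.sqrt (∑ k, z (Sum.inl k) ^ 2)) *
        Real.exp (p * β * Real.sqrt (∑ k, z (Sum.inr k) ^ 2)))
    have i1 := Integrable.stdNormalPi_sum_mul (ι := (n × m) ⊕ Unit)
      (f := fun _ => 1) (integrable_const 1) i2
    simp only [integral_const, probReal_univ, smul_eq_mul, one_mul] at h1 i1
    refine (integral_mono (integrable_expSumPow_linear hβ hp b)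
      (i1.const_mul ((Fintype.card ι : ℝ) ^ p)) fun z => ?_).trans ?_
    · simp only
      rw [← Real.exp_add, ← mul_add]
      refine expSumPow_le hβ hp fun i => ?_
      simp only [hb, Fintype.sum_sum_type, Sum.elim_inl, Sum.elim_inr]
      simp only [Pi.zero_apply, zero_mul, Finset.sum_const_zero, zero_add]
      exact add_le_add (sum_mul_le_sqrt (hu i) _) (sum_mul_le_sqrt (hv i) _)
    · rw [integral_const_mul, h1, h2]
      gcongr
  have key := left.symm.trans_le (cmp.trans right)
  rw [← le_div_iff₀ (Real.exp_pos _)] at key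
  refine key.trans_eq ?_
  rw [mul_div_assoc, ← Real.exp_add, ← Real.exp_sub]
  ring_nf

end Chevet

section Tail

variable {ι m n : Type*} [Fintype ι] [Fintype m] [Fintype n]

lemma measure_exists_bilinear_gt_le_of_fintype [Nonempty ι] [Nonempty m] [Nonempty n]
    {v : ι → n → ℝ} {u : ι → m → ℝ} (hv : ∀ i, ∑ k, v i k ^ 2 = 1)
    (hu : ∀ i, ∑ k, u i k ^ 2 = 1) {t : ℝ} (ht : 0 ≤ t) :
    stdNormalPi (n × m) {z | ∃ i, Real.sqrt (Fintype.card n) + Real.sqrt (Fintype.card m) + t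
        < ∑ q : n × m, v i q.1 * u i q.2 * z q}
      ≤ ENNReal.ofReal (Real.exp (-t ^ 2 / 2)) := by
  set r := Real.sqrt (Fintype.card n) + Real.sqrt (Fintype.card m) with hr
  set E := {z : n × m → ℝ | ∃ i, r + t < ∑ q : n × m, v i q.1 * u i q.2 * z q} with hE
  rw [← ofReal_measureReal]
  refine ENNReal.ofReal_le_ofReal ?_
  have bound : ∀ p : ℝ, 0 < p → p ≤ 1 → (stdNormalPi (n × m)).real E
      ≤ (Fintype.card ι : ℝ) ^ p * Real.exp (-t ^ 2 / 2) := by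
    intro p hp hp1
    have hβ : 0 ≤ t / p := by positivity
    have hpβ : p * (t / p) = t := mul_div_cancel₀ t hp.ne'
    have chevet := integral_expSumPow_bilinear_le hβ hp.le hp1 hv hu
    let c : ι → n × m → ℝ := fun i q => v i q.1 * u i q.2
    have hInt : Integrable (fun z : n × m → ℝ => expSumPow (t / p) p fun i => ∑ q, c i q * z q)
        (stdNormalPi (n × m)) := integrable_expSumPow_linear hβ hp.le c
    have markov := mul_meas_ge_le_integral_of_nonneg
      (Filter.Eventually.of_forall fun z => (expSumPow_pos _ _ _).le) hInt
      (Real.exp (t * (r + t)))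
    have sub : E ⊆ {z | Real.exp (t * (r + t))
        ≤ expSumPow (t / p) p fun i => ∑ q : n × m, v i q.1 * u i q.2 * z q} := by
      rintro z ⟨i, hi⟩
      refine le_trans ?_ (exp_le_expSumPow hp.le _ i)
      rw [hpβ]
      exact Real.exp_le_exp.2 (mul_le_mul_of_nonneg_left hi.le ht)
    have h := (mul_le_mul_of_nonneg_left (measureReal_mono (μ := stdNormalPi (n × m)) sub)
      (Real.exp_pos (t * (r + t))).le).trans (markov.trans chevet)
    rw [mul_comm, ← le_div_iff₀ (Real.exp_pos _), hpβ, mul_div_assoc, ← Real.exp_sub] at h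
    refine h.trans_eq ?_
    rw [hr]
    ring_nf
  have lim : Filter.Tendsto (fun p : ℝ => (Fintype.card ι : ℝ) ^ p * Real.exp (-t ^ 2 / 2))
      (nhdsWithin 0 (Set.Ioi 0)) (nhds (Real.exp (-t ^ 2 / 2))) := by
    have hc : ContinuousAt (fun p : ℝ => (Fintype.card ι : ℝ) ^ p) 0 :=
      Real.continuousAt_const_rpow (by simp)
    have := (hc.tendsto.mul_const (Real.exp (-t ^ 2 / 2))).mono_left
      (nhdsWithin_le_nhds (s := Set.Ioi 0))
    simpa using this
  refine ge_of_tendsto lim ?_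
  filter_upwards [Ioc_mem_nhdsGT (zero_lt_one (α := ℝ))] with p hp
  exact bound p hp.1 hp.2

/-- The tail bound for the operator norm of a Gaussian matrix, stated through its bilinear form
on unit vectors. -/
theorem measure_exists_bilinear_gt_le [Nonempty m] [Nonempty n] {t : ℝ} (ht : 0 ≤ t) :
    stdNormalPi (n × m) {z | ∃ (v : n → ℝ) (u : m → ℝ), ∑ k, v k ^ 2 = 1 ∧ ∑ k, u k ^ 2 = 1 ∧
        Real.sqrt (Fintype.card n) + Real.sqrt (Fintype.card m) + t
          < ∑ q : n × m, v q.1 * u q.2 * z q}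
      ≤ ENNReal.ofReal (Real.exp (-t ^ 2 / 2)) := by
  set r := Real.sqrt (Fintype.card n) + Real.sqrt (Fintype.card m) + t with hr
  let W := {w : (n → ℝ) × (m → ℝ) // ∑ k, w.1 k ^ 2 = 1 ∧ ∑ k, w.2 k ^ 2 = 1}
  rcases isEmpty_or_nonempty W with hW | hW
  · refine le_of_eq_of_le ?_ zero_le
    convert measure_empty (μ := stdNormalPi (n × m))
    ext z
    simp only [Set.mem_ofPred_eq, Set.mem_empty_iff_false, iff_false]
    rintro ⟨v, u, hv, hu, -⟩
    exact hW.false ⟨(v, u), hv, hu⟩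
  let w : ℕ → W := TopologicalSpace.denseSeq W
  let E : ℕ → Set (n × m → ℝ) := fun N =>
    {z | ∃ i : Fin (N + 1), r < ∑ q : n × m, (w i).1.1 q.1 * (w i).1.2 q.2 * z q}
  have hE : Monotone E := by
    rintro M N hMN z ⟨i, hi⟩
    exact ⟨⟨i, by omega⟩, hi⟩
  have sub : {z | ∃ (v : n → ℝ) (u : m → ℝ), ∑ k, v k ^ 2 = 1 ∧ ∑ k, u k ^ 2 = 1 ∧
      r < ∑ q : n × m, v q.1 * u q.2 * z q} ⊆ ⋃ N, E N := by
    rintro z ⟨v, u, hv, hu, h⟩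
    have hopen : IsOpen {x : W | r < ∑ q : n × m, x.1.1 q.1 * x.1.2 q.2 * z q} :=
      isOpen_lt continuous_const (by fun_prop)
    obtain ⟨k, hk⟩ := (TopologicalSpace.denseRange_denseSeq W).exists_mem_open hopen
      ⟨⟨(v, u), hv, hu⟩, h⟩
    exact Set.mem_iUnion.2 ⟨k, ⟨k, by omega⟩, hk⟩
  refine (measure_mono sub).trans ?_
  rw [hE.measure_iUnion]
  exact iSup_le fun N => measure_exists_bilinear_gt_le_of_fintype
    (v := fun i : Fin (N + 1) => (w i).1.1) (u := fun i => (w i).1.2)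
    (fun i => (w i).2.1) (fun i => (w i).2.2) ht

end Tail

section Deterministic

lemma sum_sq_mulVec_le {m n : Type*} [Fintype m] [Fintype n] {A : n → m → ℝ} {r : ℝ}
    (hr : 0 ≤ r) (h : ∀ (v : n → ℝ) (u : m → ℝ), ∑ k, v k ^ 2 = 1 → ∑ k, u k ^ 2 = 1 →
      ∑ q : n × m, v q.1 * u q.2 * A q.1 q.2 ≤ r) (x : m → ℝ) :
    Real.sqrt (∑ i, (∑ j, A i j * x j) ^ 2) ≤ r * Real.sqrt (∑ j, x j ^ 2) := by
  set w : n → ℝ := fun i => ∑ j, A i j * x j with hw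
  set a := Real.sqrt (∑ i, w i ^ 2) with ha
  set b := Real.sqrt (∑ j, x j ^ 2) with hb
  have ha2 : a ^ 2 = ∑ i, w i ^ 2 := Real.sq_sqrt (Finset.sum_nonneg fun _ _ => sq_nonneg _)
  have hb2 : b ^ 2 = ∑ j, x j ^ 2 := Real.sq_sqrt (Finset.sum_nonneg fun _ _ => sq_nonneg _)
  rcases (show 0 ≤ b from Real.sqrt_nonneg _).eq_or_lt with hb0 | hb0
  · have hx : ∀ j, x j = 0 := by
      rw [← hb0, eq_comm, zero_pow two_ne_zero,
        Finset.sum_eq_zero_iff_of_nonneg fun _ _ => sq_nonneg _] at hb2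
      exact fun j => pow_eq_zero_iff two_ne_zero |>.1 (hb2 j (Finset.mem_univ j))
    have : a = 0 := by simp [ha, hw, hx]
    rw [this, ← hb0, mul_zero]
  rcases (show 0 ≤ a from Real.sqrt_nonneg _).eq_or_lt with ha0 | ha0
  · rw [← ha0]
    positivity
  have key := h (fun i => w i / a) (fun j => x j / b)
    (by simp_rw [div_pow]; rw [← Finset.sum_div, ← ha2]; field_simp)
    (by simp_rw [div_pow]; rw [← Finset.sum_div, ← hb2]; field_simp)
  have e : ∑ q : n × m, w q.1 / a * (x q.2 / b) * A q.1 q.2 = a / b := by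
    rw [Fintype.sum_prod_type]
    have : ∀ i, ∑ j, w i / a * (x j / b) * A i j = w i ^ 2 / (a * b) := by
      intro i
      rw [pow_two, mul_div_right_comm]
      nth_rewrite 3 [hw]
      rw [Finset.mul_sum]
      exact Finset.sum_congr rfl fun j _ => by field_simp
    simp_rw [this]
    rw [← Finset.sum_div, ← ha2]
    field_simp
  rw [e, div_le_iff₀ hb0] at key
  exact key

lemma sum_sq_sub_mean_le {n : ℕ} (w : Fin n → ℝ) :
    ∑ i, (w i - (n : ℝ)⁻¹ * ∑ i', w i') ^ 2 ≤ ∑ i, w i ^ 2 := by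
  rcases Nat.eq_zero_or_pos n with rfl | hn
  · simp
  have hn' : (n : ℝ) ≠ 0 := by positivity
  set s := ∑ i', w i' with hs
  have : ∑ i, (w i - (n : ℝ)⁻¹ * s) ^ 2 = ∑ i, w i ^ 2 - (n : ℝ)⁻¹ * s ^ 2 := by
    have h : ∀ i, (w i - (n : ℝ)⁻¹ * s) ^ 2
        = w i ^ 2 - 2 * (n : ℝ)⁻¹ * s * w i + ((n : ℝ)⁻¹ * s) ^ 2 := fun i => by ring
    simp_rw [h, Finset.sum_add_distrib, Finset.sum_sub_distrib, ← Finset.mul_sum, ← hs]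
    simp only [Finset.sum_const, Finset.card_univ, Fintype.card_fin, nsmul_eq_mul]
    field_simp
    ring
  rw [this]
  have : 0 ≤ (n : ℝ)⁻¹ * s ^ 2 := by positivity
  linarith

lemma norm_gram_le {d n : ℕ} {B : Fin n → Fin d → ℝ} {r : ℝ} (hr : 0 ≤ r)
    (hB : ∀ x : Fin d → ℝ,
      Real.sqrt (∑ i, (∑ j, B i j * x j) ^ 2) ≤ r * Real.sqrt (∑ j, x j ^ 2)) :
    ‖Matrix.toEuclideanCLM (𝕜 := ℝ)
        (Matrix.of fun j k : Fin d => (n : ℝ)⁻¹ * ∑ i, B i j * B i k)‖ ≤ (n : ℝ)⁻¹ * r ^ 2 := by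
  refine ContinuousLinearMap.opNorm_le_bound _ (by positivity) fun x => ?_
  set y := Matrix.toEuclideanCLM (𝕜 := ℝ)
    (Matrix.of fun j k : Fin d => (n : ℝ)⁻¹ * ∑ i, B i j * B i k) x with hy
  have hyj : ∀ j, y j = (n : ℝ)⁻¹ * ∑ i, B i j * ∑ k, B i k * x k := by
    intro j
    rw [hy, Matrix.ofLp_toEuclideanCLM, Matrix.mulVec, dotProduct]
    simp only [Matrix.of_apply, Finset.mul_sum, Finset.sum_mul]
    rw [Finset.sum_comm]
    exact Finset.sum_congr rfl fun _ _ => Finset.sum_congr rfl fun _ _ => by ring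
  have hnorm : ∀ z : EuclideanSpace ℝ (Fin d), ‖z‖ = Real.sqrt (∑ j, z j ^ 2) := fun z => by
    rw [EuclideanSpace.norm_eq]; simp
  have hsq : ‖y‖ ^ 2 = (n : ℝ)⁻¹ * ∑ i, (∑ j, B i j * y j) * ∑ k, B i k * x k := by
    rw [hnorm, Real.sq_sqrt (Finset.sum_nonneg fun _ _ => sq_nonneg _)]
    have : ∀ j, y j ^ 2 = (n : ℝ)⁻¹ * ∑ i, B i j * y j * ∑ k, B i k * x k := fun j => by
      rw [pow_two]
      nth_rewrite 1 [hyj]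
      rw [mul_assoc, Finset.sum_mul]
      congr 1
      exact Finset.sum_congr rfl fun _ _ => by ring
    simp_rw [this, ← Finset.mul_sum, Finset.sum_mul]
    rw [Finset.sum_comm]
  have hle : ‖y‖ ^ 2 ≤ (n : ℝ)⁻¹ * r ^ 2 * ‖x‖ * ‖y‖ := by
    have cs := Real.sum_mul_le_sqrt_mul_sqrt Finset.univ (fun i => ∑ j, B i j * y j)
      fun i => ∑ k, B i k * x k
    have hBy := hB y
    have hBx := hB x
    rw [← hnorm] at hBy hBx
    have h := cs.trans (mul_le_mul hBy hBx (Real.sqrt_nonneg _) (by positivity))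
    rw [hsq]
    calc _ ≤ (n : ℝ)⁻¹ * (r * ‖y‖ * (r * ‖x‖)) :=
          mul_le_mul_of_nonneg_left h (by positivity)
      _ = _ := by ring
  rcases (norm_nonneg y).eq_or_lt with h0 | h0
  · rw [← h0]; positivity
  · rw [pow_two] at hle
    exact le_of_mul_le_mul_right hle h0

end Deterministic

lemma measurePreserving_curry_add {d n : ℕ} (μ : Fin d → ℝ) :
    MeasurePreserving (fun (z : Fin n × Fin d → ℝ) i j => z (i, j) + μ j)
      (stdNormalPi (Fin n × Fin d))
      (Measure.pi fun _ : Fin n => Measure.pi fun j : Fin d => gaussianReal (μ j) 1) := by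
  have hcurry : MeasurePreserving (MeasurableEquiv.curry (Fin n) (Fin d) ℝ)
      (stdNormalPi (Fin n × Fin d)) (Measure.pi fun _ : Fin n => stdNormalPi (Fin d)) := by
    refine ⟨MeasurableEquiv.measurable _, ?_⟩
    have := Measure.infinitePi_map_curry
      (fun (_ : Fin n) (_ : Fin d) => gaussianReal 0 1)
    simpa only [Measure.infinitePi_eq_pi] using this
  have hshift : ∀ j, MeasurePreserving (fun x : ℝ => x + μ j)
      (gaussianReal 0 1) (gaussianReal (μ j) 1) := fun j =>
    ⟨by fun_prop, by rw [gaussianReal_map_add_const, zero_add]⟩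
  have hrow : MeasurePreserving (fun (x : Fin d → ℝ) j => x j + μ j) (stdNormalPi (Fin d))
      (Measure.pi fun j : Fin d => gaussianReal (μ j) 1) := measurePreserving_pi _ _ hshift
  have hadd : MeasurePreserving (fun (X : Fin n → Fin d → ℝ) i j => X i j + μ j)
      (Measure.pi fun _ : Fin n => stdNormalPi (Fin d))
      (Measure.pi fun _ : Fin n => Measure.pi fun j : Fin d => gaussianReal (μ j) 1) :=
    measurePreserving_pi _ _ fun _ => hrow
  exact hadd.comp hcurry

/-- Let `X` be an `n × d` matrix with rows i.i.d. from `N(μ, I_d)`, let `μ̄` be the mean of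
the rows and `Σ = (1/n)(X - μ̄)ᵀ(X - μ̄)` the sample covariance matrix.  Then for every
`t > 0`, with probability at least `1 - 3 exp(-t²/2)`, the spectral norm of `Σ` satisfies
`‖Σ‖₂ ≤ (1 + √(d/n) + t/√n + √(d + √(2d)·t + t²)/n)²`. -/
theorem sample_covariance_spectral_norm_bound (d n : ℕ) (hn : 0 < n)
    (μ : Fin d → ℝ) (t : ℝ) (ht : 0 < t) :
    ENNReal.ofReal (1 - 3 * Real.exp (-t ^ 2 / 2)) ≤
      (Measure.pi fun _ : Fin n => Measure.pi fun j : Fin d => gaussianReal (μ j) 1)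
        {X | ‖Matrix.toEuclideanCLM (𝕜 := ℝ)
            (Matrix.of fun j k : Fin d =>
              (n : ℝ)⁻¹ * ∑ i, (X i j - (n : ℝ)⁻¹ * ∑ i', X i' j)
                * (X i k - (n : ℝ)⁻¹ * ∑ i', X i' k))‖
          ≤ (1 + Real.sqrt (d / n) + t / Real.sqrt n
              + Real.sqrt ((d : ℝ) + Real.sqrt (2 * d) * t + t ^ 2) / n) ^ 2} := by
  have hmp := measurePreserving_curry_add (n := n) μ
  rw [← hmp.map_eq]
  refine le_trans ?_ (Measure.le_map_apply hmp.aemeasurable _)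
  have hn' : (0 : ℝ) < n := by exact_mod_cast hn
  have hsn : 0 < Real.sqrt n := Real.sqrt_pos.2 hn'
  set r := Real.sqrt n + Real.sqrt d + t with hr
  have hr0 : 0 ≤ r := by positivity
  set bad := {z : Fin n × Fin d → ℝ | ∃ (v : Fin n → ℝ) (u : Fin d → ℝ), ∑ k, v k ^ 2 = 1 ∧
    ∑ k, u k ^ 2 = 1 ∧ r < ∑ q : Fin n × Fin d, v q.1 * u q.2 * z q} with hbad
  have hbad_le : stdNormalPi (Fin n × Fin d) bad ≤ ENNReal.ofReal (Real.exp (-t ^ 2 / 2)) := by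
    rcases Nat.eq_zero_or_pos d with rfl | hd
    · simp [hbad]
    · have : Nonempty (Fin n) := ⟨⟨0, hn⟩⟩
      have : Nonempty (Fin d) := ⟨⟨0, hd⟩⟩
      simpa [hbad, hr] using measure_exists_bilinear_gt_le (n := Fin n) (m := Fin d) ht.le
  have hgood : ENNReal.ofReal (1 - 3 * Real.exp (-t ^ 2 / 2))
      ≤ stdNormalPi (Fin n × Fin d) badᶜ := by
    have h1 : 1 ≤ stdNormalPi (Fin n × Fin d) bad + stdNormalPi (Fin n × Fin d) badᶜ := by
      rw [← measure_univ (μ := stdNormalPi (Fin n × Fin d)), ← Set.union_compl_self bad]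
      exact measure_union_le _ _
    have h2 := h1.trans (add_le_add_left hbad_le _)
    calc ENNReal.ofReal (1 - 3 * Real.exp (-t ^ 2 / 2))
        ≤ ENNReal.ofReal (1 - Real.exp (-t ^ 2 / 2)) :=
          ENNReal.ofReal_le_ofReal (by linarith [Real.exp_pos (-t ^ 2 / 2)])
      _ = 1 - ENNReal.ofReal (Real.exp (-t ^ 2 / 2)) := by
          rw [ENNReal.ofReal_sub _ (Real.exp_pos _).le, ENNReal.ofReal_one]
      _ ≤ _ := tsub_le_iff_left.2 h2
  refine hgood.trans (measure_mono fun z hz => ?_)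
  have hA := sum_sq_mulVec_le (A := fun i j => z (i, j)) hr0 fun v u hv hu =>
    not_lt.1 fun hlt => hz ⟨v, u, hv, hu, hlt⟩
  simp only [Set.mem_preimage, Set.mem_ofPred_eq]
  refine (norm_gram_le hr0 fun x => ?_).trans ?_
  · refine le_trans (Real.sqrt_le_sqrt ?_) (hA x)
    refine le_trans (le_of_eq ?_) (sum_sq_sub_mean_le fun i => ∑ j, z (i, j) * x j)
    refine Finset.sum_congr rfl fun i _ => ?_
    congr 1
    rw [Finset.sum_comm, Finset.mul_sum, ← Finset.sum_sub_distrib]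
    refine Finset.sum_congr rfl fun j _ => ?_
    rw [Finset.sum_add_distrib, ← Finset.sum_mul]
    simp only [Finset.sum_const, Finset.card_univ, Fintype.card_fin, nsmul_eq_mul]
    field_simp
    ring
  · have e : (n : ℝ)⁻¹ * r ^ 2 = (1 + Real.sqrt (d / n) + t / Real.sqrt n) ^ 2 := by
      rw [Real.sqrt_div (Nat.cast_nonneg d), show 1 + Real.sqrt d / Real.sqrt n + t / Real.sqrt n
        = r / Real.sqrt n by rw [hr]; field_simp, div_pow, Real.sq_sqrt hn'.le]
      ring
    rw [e]
    refine pow_le_pow_left₀ (by positivity) (le_add_of_nonneg_right (by positivity)) 2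
end

section
/- Let X be an n × d matrix with i.i.d. N(μ, 1) entries, μ̄ the sample mean of the rows, and Σ = (1/n)(X - μ̄)^T(X - μ̄). If d/n ≤ 16, n ≥ 16, and t ≥ 5, then with probability at least 1 - 3*exp(-t^2/8), ||Σ||_2 ≤ (1 + sqrt(d/n) + t/sqrt(n))^2. -/
open MeasureTheory ProbabilityTheory

/-- **Stein's identity** for the standard Gaussian on the line. -/
theorem integral_id_mul_gaussianReal_s9 {f g : ℝ → ℝ} {C : ℝ} (hgm : Measurable g)
    (hf : ∀ x, HasDerivAt f (g x) x) (hfC : ∀ x, |f x| ≤ C) (hgC : ∀ x, |g x| ≤ C) :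
    ∫ x, x * f x ∂gaussianReal 0 1 = ∫ x, g x ∂gaussianReal 0 1 := by
  have hpdf (x : ℝ) : HasDerivAt (gaussianPDFReal 0 1) (-x * gaussianPDFReal 0 1 x) x := by
    simp only [gaussianPDFReal_def]
    have h : HasDerivAt (fun y : ℝ ↦ -(y - 0) ^ 2 / (2 * ((1 : NNReal) : ℝ))) (-x) x := by
      have := (((hasDerivAt_id x).sub_const 0).pow 2).neg.div_const (2 * ((1 : NNReal) : ℝ))
      convert! this using 1
      simp
      ring
    convert! h.exp.const_mul _ using 1
    ring
  have hfm : Measurable f :=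
    (continuous_iff_continuousAt.2 fun x ↦ (hf x).continuousAt).measurable
  have hpi := integrable_gaussianPDFReal 0 1
  have hxp : Integrable fun x : ℝ ↦ -x * gaussianPDFReal 0 1 x := by
    have h := ((integrable_mul_exp_neg_mul_sq (b := 1 / 2) (by norm_num)).const_mul
      (-(√(2 * Real.pi * ((1 : NNReal) : ℝ)))⁻¹))
    refine h.congr (ae_of_all _ fun x ↦ ?_)
    simp only [gaussianPDFReal_def]
    ring_nf
    simp
  have hC : ∀ h : ℝ → ℝ, (∀ x, |h x| ≤ C) → ∀ᵐ x : ℝ, ‖h x‖ ≤ C :=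
    fun h hh ↦ ae_of_all _ fun x ↦ hh x
  have key := integral_mul_deriv_eq_deriv_mul_of_integrable (u := f) (u' := g)
    (v := gaussianPDFReal 0 1) (v' := fun x ↦ -x * gaussianPDFReal 0 1 x)
    (fun x _ ↦ hf x) (fun x _ ↦ hpdf x)
    (hxp.bdd_mul hfm.aestronglyMeasurable (hC f hfC))
    (hpi.bdd_mul hgm.aestronglyMeasurable (hC g hgC))
    (hpi.bdd_mul hfm.aestronglyMeasurable (hC f hfC))
  rw [integral_gaussianReal_eq_integral_smul one_ne_zero,
    integral_gaussianReal_eq_integral_smul one_ne_zero]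
  simp only [smul_eq_mul]
  rw [← neg_inj, ← integral_neg]
  simp only [mul_comm (gaussianPDFReal 0 1 _) (g _)]
  rw [← key]
  exact integral_congr_ae (ae_of_all _ fun x ↦ by ring)

theorem measurePreserving_update_s9 {ι : Type*} [Fintype ι] [DecidableEq ι] (ν : ι → Measure ℝ)
    [∀ i, IsProbabilityMeasure (ν i)] (k : ι) :
    MeasurePreserving (fun p : (ι → ℝ) × ℝ ↦ Function.update p.1 k p.2)
      ((Measure.pi ν).prod (ν k)) (Measure.pi ν) := by
  have hm : Measurable fun p : (ι → ℝ) × ℝ ↦ Function.update p.1 k p.2 := by fun_prop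
  refine ⟨hm, (Measure.pi_eq fun s hs ↦ ?_).symm⟩
  have hpre : (fun p : (ι → ℝ) × ℝ ↦ Function.update p.1 k p.2) ⁻¹' Set.univ.pi s
      = (Set.univ.pi (Function.update s k Set.univ)) ×ˢ s k := by
    ext ⟨w, x⟩
    simp only [Set.mem_preimage, Set.mem_univ_pi, Set.mem_prod]
    constructor
    · intro h
      refine ⟨fun i ↦ ?_, by simpa using h k⟩
      rcases eq_or_ne i k with rfl | hi
      · simp
      · simpa [hi] using h i
    · rintro ⟨h, hx⟩ i
      rcases eq_or_ne i k with rfl | hi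
      · simpa using hx
      · simpa [hi] using h i
  rw [Measure.map_apply hm (.univ_pi hs), hpre, Measure.prod_prod, Measure.pi_pi,
    ← Finset.prod_erase_mul Finset.univ (fun i ↦ ν i (s i)) (Finset.mem_univ k),
    ← Finset.prod_erase_mul Finset.univ _ (Finset.mem_univ k)]
  simp only [Function.update_self, measure_univ, mul_one]
  congr 1
  exact Finset.prod_congr rfl fun i hi ↦ by simp [Finset.ne_of_mem_erase hi]

/-- **Stein's identity** in one coordinate of a standard Gaussian vector. -/
theorem integral_eval_mul_pi_gaussianReal {ι : Type*} [Fintype ι] [DecidableEq ι] (k : ι)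
    {f g : (ι → ℝ) → ℝ} {C : ℝ} (hfm : Measurable f) (hgm : Measurable g)
    (hf : ∀ w x, HasDerivAt (fun y ↦ f (Function.update w k y)) (g (Function.update w k x)) x)
    (hfC : ∀ w, |f w| ≤ C) (hgC : ∀ w, |g w| ≤ C) :
    ∫ w, w k * f w ∂(Measure.pi fun _ : ι ↦ gaussianReal 0 1)
      = ∫ w, g w ∂(Measure.pi fun _ : ι ↦ gaussianReal 0 1) := by
  have hmp := measurePreserving_update_s9 (fun _ : ι ↦ gaussianReal 0 1) k
  have hfi : Integrable (fun w : ι → ℝ ↦ w k * f w)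
      (Measure.pi fun _ : ι ↦ gaussianReal 0 1) :=
    (integrable_eval (memLp_one_iff_integrable.1 (memLp_id_gaussianReal 1))).mul_bdd
      hfm.aestronglyMeasurable (ae_of_all _ hfC)
  have hgi : Integrable g (Measure.pi fun _ : ι ↦ gaussianReal 0 1) :=
    Integrable.of_bound hgm.aestronglyMeasurable C (ae_of_all _ hgC)
  rw [← hmp.map_eq, integral_map hmp.measurable.aemeasurable,
    integral_map hmp.measurable.aemeasurable, integral_prod, integral_prod]
  · refine integral_congr_ae (ae_of_all _ fun w ↦ ?_)
    simp only [Function.update_self]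
    exact integral_id_mul_gaussianReal_s9 (C := C) (by fun_prop) (hf w) (fun _ ↦ hfC _) fun _ ↦ hgC _
  · exact hmp.integrable_comp_of_integrable hgi
  · exact hmp.integrable_comp_of_integrable hfi
  · rw [hmp.map_eq]; exact hgi.aestronglyMeasurable
  · rw [hmp.map_eq]; exact hfi.aestronglyMeasurable

theorem exp_mul_exp_neg_sum_le {I : Type*} [Fintype I] (z : I → ℝ) (i : I) :
    Real.exp (z i) * Real.exp (-∑ j, Real.exp (z j)) ≤ 1 := by
  have h : Real.exp (z i) ≤ ∑ j, Real.exp (z j) :=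
    Finset.single_le_sum (fun j _ ↦ (Real.exp_pos (z j)).le) (Finset.mem_univ i)
  rw [Real.exp_neg, ← div_eq_mul_inv, div_le_one (Real.exp_pos _)]
  linarith [Real.add_one_le_exp (∑ j, Real.exp (z j))]

theorem exp_mul_exp_mul_exp_neg_sum_le {I : Type*} [Fintype I] (z : I → ℝ) (i j : I) :
    Real.exp (z i) * Real.exp (z j) * Real.exp (-∑ l, Real.exp (z l)) ≤ 4 := by
  have h (i : I) : Real.exp (z i) ≤ ∑ j, Real.exp (z j) :=
    Finset.single_le_sum (fun j _ ↦ (Real.exp_pos (z j)).le) (Finset.mem_univ i)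
  set S := ∑ j, Real.exp (z j)
  rw [Real.exp_neg, ← div_eq_mul_inv, div_le_iff₀ (Real.exp_pos _)]
  have hS : Real.exp S = Real.exp (S / 2) * Real.exp (S / 2) := by
    rw [← Real.exp_add, add_halves]
  have h0 : 0 < Real.exp (z i) := Real.exp_pos _
  have h1 := Real.add_one_le_exp (S / 2)
  have h2 := h i
  calc Real.exp (z i) * Real.exp (z j) ≤ S * S :=
        mul_le_mul (h i) (h j) (Real.exp_pos _).le (h0.le.trans h2)
    _ ≤ (2 * Real.exp (S / 2)) * (2 * Real.exp (S / 2)) := by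
        gcongr <;> linarith
    _ = 4 * Real.exp S := by rw [hS]; ring

section Comparison

variable {ι I : Type*} [Fintype ι] [Fintype I]

/-- Gaussian integration by parts for the partial derivatives of `exp (-∑ exp zᵢ)`. -/
theorem integral_dotProduct_mul_exp_neg_sum (A : I → ι → ℝ) (c : I → ℝ) (v : ι → ℝ) (i : I) :
    ∫ w, (v ⬝ᵥ w) * (Real.exp (A i ⬝ᵥ w + c i) * Real.exp (-∑ j, Real.exp (A j ⬝ᵥ w + c j)))
        ∂(Measure.pi fun _ : ι ↦ gaussianReal 0 1)
      = (v ⬝ᵥ A i) * ∫ w, Real.exp (A i ⬝ᵥ w + c i) *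
            Real.exp (-∑ j, Real.exp (A j ⬝ᵥ w + c j))
            ∂(Measure.pi fun _ : ι ↦ gaussianReal 0 1)
        - ∑ j, (v ⬝ᵥ A j) * ∫ w, Real.exp (A i ⬝ᵥ w + c i) * Real.exp (A j ⬝ᵥ w + c j) *
            Real.exp (-∑ j, Real.exp (A j ⬝ᵥ w + c j))
            ∂(Measure.pi fun _ : ι ↦ gaussianReal 0 1) := by
  classical
  set γ := Measure.pi fun _ : ι ↦ gaussianReal 0 1
  set f : (ι → ℝ) → ℝ := fun w ↦
    Real.exp (A i ⬝ᵥ w + c i) * Real.exp (-∑ j, Real.exp (A j ⬝ᵥ w + c j)) with hf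
  set h : I → (ι → ℝ) → ℝ := fun j w ↦
    Real.exp (A i ⬝ᵥ w + c i) * Real.exp (A j ⬝ᵥ w + c j) *
      Real.exp (-∑ j, Real.exp (A j ⬝ᵥ w + c j)) with hh
  have hdot (u : ι → ℝ) : Measurable fun w : ι → ℝ ↦ u ⬝ᵥ w := by
    unfold dotProduct; fun_prop
  have hfm : Measurable f := by
    have := fun j ↦ hdot (A j)
    fun_prop
  have hhm (j : I) : Measurable (h j) := by
    have := fun j ↦ hdot (A j)
    fun_prop
  have hfC (w : ι → ℝ) : |f w| ≤ 1 := by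
    rw [abs_of_nonneg (by positivity)]
    exact exp_mul_exp_neg_sum_le (fun j ↦ A j ⬝ᵥ w + c j) i
  have hhC (j : I) (w : ι → ℝ) : |h j w| ≤ 4 := by
    rw [abs_of_nonneg (by positivity)]
    exact exp_mul_exp_mul_exp_neg_sum_le (fun j ↦ A j ⬝ᵥ w + c j) i j
  have hfi : Integrable f γ := .of_bound hfm.aestronglyMeasurable 1 (ae_of_all _ hfC)
  have hhi (j : I) : Integrable (h j) γ :=
    .of_bound (hhm j).aestronglyMeasurable 4 (ae_of_all _ (hhC j))
  have hstein (k : ι) : ∫ w, w k * f w ∂γ = ∫ w, A i k * f w - ∑ j, A j k * h j w ∂γ := by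
    refine integral_eval_mul_pi_gaussianReal k (C := 1 + |A i k| + ∑ j, |A j k| * 4) hfm
      (by fun_prop) (fun w x ↦ ?_) (fun w ↦ ?_) (fun w ↦ ?_)
    · have hz (j : I) : HasDerivAt (fun y ↦ A j ⬝ᵥ Function.update w k y + c j) (A j k) x := by
        have h1 : HasDerivAt (fun y ↦ Function.update w k y) (Pi.single k 1) x :=
          hasDerivAt_update w k x
        have h2 := HasDerivAt.fun_sum (u := Finset.univ)
          fun l _ ↦ ((hasDerivAt_pi.1 h1) l).const_mul (A j l)
        have h3 := h2.add_const (c j)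
        convert! h3 using 1
        simp [Pi.single_apply]
      have h1 := (hz i).exp.fun_mul
        (HasDerivAt.fun_sum (u := Finset.univ) fun j _ ↦ (hz j).exp).fun_neg.exp
      convert! h1 using 1
      simp only [hf, hh, Finset.mul_sum, mul_neg, sub_eq_add_neg]
      congr 1
      · ring
      · congr 1
        exact Finset.sum_congr rfl fun j _ ↦ by ring
    · have : 0 ≤ ∑ j, |A j k| * 4 := by positivity
      linarith [hfC w, abs_nonneg (A i k)]
    · refine (abs_sub _ _).trans ?_
      rw [abs_mul]
      have h1 : |A i k| * |f w| ≤ |A i k| := mul_le_of_le_one_right (abs_nonneg _) (hfC w)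
      have h2 : |∑ j, A j k * h j w| ≤ ∑ j, |A j k| * 4 := by
        refine (Finset.abs_sum_le_sum_abs _ _).trans (Finset.sum_le_sum fun j _ ↦ ?_)
        rw [abs_mul]
        exact mul_le_mul_of_nonneg_left (hhC j w) (abs_nonneg _)
      linarith
  have hwf (k : ι) : Integrable (fun w : ι → ℝ ↦ w k * f w) γ :=
    (integrable_eval (memLp_one_iff_integrable.1 (memLp_id_gaussianReal 1))).mul_bdd
      hfm.aestronglyMeasurable (ae_of_all _ hfC)
  have hexp (w : ι → ℝ) : (v ⬝ᵥ w) * f w = ∑ k, v k * (w k * f w) := by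
    simp only [dotProduct, Finset.sum_mul, mul_assoc]
  change ∫ w, (v ⬝ᵥ w) * f w ∂γ
    = (v ⬝ᵥ A i) * ∫ w, f w ∂γ - ∑ j, (v ⬝ᵥ A j) * ∫ w, h j w ∂γ
  simp only [hexp]
  rw [integral_finsetSum _ fun k _ ↦ (hwf k).const_mul _]
  simp only [integral_const_mul, hstein]
  have hsplit (k : ι) : ∫ w, A i k * f w - ∑ j, A j k * h j w ∂γ
      = A i k * ∫ w, f w ∂γ - ∑ j, A j k * ∫ w, h j w ∂γ := by
    rw [integral_sub (hfi.const_mul _) (integrable_finsetSum _ fun j _ ↦ (hhi j).const_mul _),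
      integral_finsetSum _ fun j _ ↦ (hhi j).const_mul _]
    simp only [integral_const_mul]
  simp only [hsplit, mul_sub, Finset.sum_sub_distrib, dotProduct, Finset.sum_mul, Finset.mul_sum]
  rw [Finset.sum_comm (γ := I)]
  simp only [mul_assoc]

/-- A **Slepian-type comparison**: if two independent centred Gaussian vectors have equal variances
and the first has the larger covariances, then it has the larger expectation of
`exp (-∑ exp zᵢ)`. -/
theorem integral_exp_neg_sum_exp_le (a b : I → ι → ℝ) (c : I → ℝ)
    (hab : ∀ i j, a i ⬝ᵥ b j = 0) (hvar : ∀ i, a i ⬝ᵥ a i = b i ⬝ᵥ b i)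
    (hcov : ∀ i j, b i ⬝ᵥ b j ≤ a i ⬝ᵥ a j) :
    ∫ w, Real.exp (-∑ i, Real.exp (b i ⬝ᵥ w + c i)) ∂(Measure.pi fun _ : ι ↦ gaussianReal 0 1)
      ≤ ∫ w, Real.exp (-∑ i, Real.exp (a i ⬝ᵥ w + c i))
          ∂(Measure.pi fun _ : ι ↦ gaussianReal 0 1) := by
  set γ := Measure.pi fun _ : ι ↦ gaussianReal 0 1
  set A : ℝ → I → ι → ℝ := fun θ i ↦ Real.cos θ • b i + Real.sin θ • a i with hA
  set D : ℝ → I → ι → ℝ := fun θ i ↦ -Real.sin θ • b i + Real.cos θ • a i with hD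
  have hdot (u : ι → ℝ) : Measurable fun w : ι → ℝ ↦ u ⬝ᵥ w := by
    unfold dotProduct; fun_prop
  set F : ℝ → (ι → ℝ) → ℝ := fun θ w ↦ Real.exp (-∑ i, Real.exp (A θ i ⬝ᵥ w + c i)) with hF
  set F' : ℝ → (ι → ℝ) → ℝ := fun θ w ↦ -∑ i, (D θ i ⬝ᵥ w) *
    (Real.exp (A θ i ⬝ᵥ w + c i) * Real.exp (-∑ j, Real.exp (A θ j ⬝ᵥ w + c j))) with hF'
  have hFm (θ : ℝ) : Measurable (F θ) := by
    have := fun j ↦ hdot (A θ j)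
    fun_prop
  have hF'm (θ : ℝ) : Measurable (F' θ) := by
    have := fun j ↦ hdot (A θ j)
    have := fun j ↦ hdot (D θ j)
    fun_prop
  have hdoti (u : ι → ℝ) : Integrable (fun w : ι → ℝ ↦ u ⬝ᵥ w) γ :=
    integrable_finsetSum _ fun k _ ↦
      (integrable_eval (memLp_one_iff_integrable.1 (memLp_id_gaussianReal 1))).const_mul _
  have hderiv (θ : ℝ) : HasDerivAt (fun θ ↦ ∫ w, F θ w ∂γ) (∫ w, F' θ w ∂γ) θ := by
    refine (hasDerivAt_integral_of_dominated_loc_of_deriv_le (F := F) (F' := F')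
      (bound := fun w ↦ ∑ i, (|b i ⬝ᵥ w| + |a i ⬝ᵥ w|)) (s := Set.univ) Filter.univ_mem
      (.of_forall fun θ ↦ (hFm θ).aestronglyMeasurable) ?_ (hF'm θ).aestronglyMeasurable
      (ae_of_all _ fun w θ _ ↦ ?_)
      (integrable_finsetSum _ fun i _ ↦ (hdoti _).abs.add (hdoti _).abs)
      (ae_of_all _ fun w θ _ ↦ ?_)).2
    · refine .of_bound (hFm θ).aestronglyMeasurable 1 (ae_of_all _ fun w ↦ ?_)
      rw [Real.norm_eq_abs, abs_of_nonneg (Real.exp_pos _).le, Real.exp_le_one_iff, neg_nonpos]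
      positivity
    · rw [norm_neg]
      refine (norm_sum_le _ _).trans (Finset.sum_le_sum fun i _ ↦ ?_)
      rw [norm_mul, Real.norm_eq_abs, Real.norm_eq_abs]
      refine (mul_le_of_le_one_right (abs_nonneg _) ?_).trans ?_
      · rw [abs_of_nonneg (by positivity)]
        exact exp_mul_exp_neg_sum_le (fun j ↦ A θ j ⬝ᵥ w + c j) i
      · simp only [hD, add_dotProduct, smul_dotProduct, smul_eq_mul]
        refine (abs_add_le _ _).trans (add_le_add ?_ ?_) <;> rw [abs_mul]
        · rw [abs_neg]
          exact mul_le_of_le_one_left (abs_nonneg _) (Real.abs_sin_le_one θ)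
        · exact mul_le_of_le_one_left (abs_nonneg _) (Real.abs_cos_le_one θ)
    · have hz (j : I) : HasDerivAt (fun θ ↦ A θ j ⬝ᵥ w + c j) (D θ j ⬝ᵥ w) θ := by
        simp only [hA, hD, add_dotProduct, smul_dotProduct, smul_eq_mul]
        exact (((Real.hasDerivAt_cos θ).mul_const _).add
          ((Real.hasDerivAt_sin θ).mul_const _)).add_const _
      have h1 := (HasDerivAt.fun_sum (u := Finset.univ) fun j _ ↦ (hz j).exp).fun_neg.exp
      convert! h1 using 1
      simp only [hF', Finset.mul_sum, mul_neg]
      congr 1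
      exact Finset.sum_congr rfl fun j _ ↦ by ring
  have hDA (θ : ℝ) (i j : I) : D θ i ⬝ᵥ A θ j
      = Real.sin θ * Real.cos θ * (a i ⬝ᵥ a j - b i ⬝ᵥ b j) := by
    have hba : b i ⬝ᵥ a j = 0 := by rw [dotProduct_comm]; exact hab j i
    simp only [hA, hD, add_dotProduct, smul_dotProduct, dotProduct_add, dotProduct_smul,
      smul_eq_mul, hab, hba]
    ring
  have hnonneg (θ : ℝ) (hθ : θ ∈ Set.Ioo 0 (Real.pi / 2)) : 0 ≤ ∫ w, F' θ w ∂γ := by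
    have hterm (i : I) : Integrable (fun w ↦ (D θ i ⬝ᵥ w) *
        (Real.exp (A θ i ⬝ᵥ w + c i) * Real.exp (-∑ j, Real.exp (A θ j ⬝ᵥ w + c j)))) γ := by
      refine (hdoti _).mul_bdd (c := 1) ?_ (ae_of_all _ fun w ↦ ?_)
      · have := fun j ↦ hdot (A θ j)
        exact Measurable.aestronglyMeasurable (by fun_prop)
      · rw [Real.norm_eq_abs, abs_of_nonneg (by positivity)]
        exact exp_mul_exp_neg_sum_le (fun j ↦ A θ j ⬝ᵥ w + c j) i
    simp only [hF']
    rw [integral_neg, integral_finsetSum _ fun i _ ↦ hterm i, ← Finset.sum_neg_distrib]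
    refine Finset.sum_nonneg fun i _ ↦ ?_
    rw [integral_dotProduct_mul_exp_neg_sum, hDA, hvar, sub_self, mul_zero, zero_mul, zero_sub,
      neg_neg]
    refine Finset.sum_nonneg fun j _ ↦ mul_nonneg ?_ (integral_nonneg fun w ↦ by positivity)
    rw [hDA]
    have hs : 0 ≤ Real.sin θ := Real.sin_nonneg_of_nonneg_of_le_pi hθ.1.le (by linarith [hθ.2, Real.pi_pos])
    have hc : 0 ≤ Real.cos θ :=
      Real.cos_nonneg_of_neg_pi_div_two_le_of_le (by linarith [hθ.1, hθ.2]) hθ.2.le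
    exact mul_nonneg (mul_nonneg hs hc) (sub_nonneg.2 (hcov i j))
  have hmono : MonotoneOn (fun θ ↦ ∫ w, F θ w ∂γ) (Set.Icc 0 (Real.pi / 2)) := by
    refine monotoneOn_of_deriv_nonneg (convex_Icc _ _)
      (fun θ _ ↦ (hderiv θ).continuousAt.continuousWithinAt)
      (fun θ _ ↦ (hderiv θ).differentiableAt.differentiableWithinAt) fun θ hθ ↦ ?_
    rw [interior_Icc] at hθ
    rw [(hderiv θ).deriv]
    exact hnonneg θ hθ
  have hpi : (0 : ℝ) ≤ Real.pi / 2 := by positivity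
  simpa [hF, hA] using hmono (Set.left_mem_Icc.2 hpi) (Set.right_mem_Icc.2 hpi) hpi

end Comparison

/-- The moment generating function of the square of a standard Gaussian, bounded above. -/
theorem integral_exp_sq_gaussianReal_le {x : ℝ} (hx : x < 1) :
    Integrable (fun y : ℝ ↦ Real.exp (x / 2 * y ^ 2)) (gaussianReal 0 1) ∧
      ∫ y, Real.exp (x / 2 * y ^ 2) ∂gaussianReal 0 1 ≤ Real.exp (x / (2 * (1 - x))) := by
  have hx' : 0 < 1 - x := sub_pos.2 hx
  have hpt (y : ℝ) : gaussianPDFReal 0 1 y * Real.exp (x / 2 * y ^ 2)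
      = (√(2 * Real.pi))⁻¹ * Real.exp (-((1 - x) / 2) * y ^ 2) := by
    rw [gaussianPDFReal_def, mul_assoc, ← Real.exp_add]
    simp only [NNReal.coe_one, mul_one, sub_zero]
    congr 2
    ring
  constructor
  · rw [gaussianReal_of_var_ne_zero _ one_ne_zero, integrable_withDensity_iff_integrable_smul'
      (measurable_gaussianPDF _ _) (ae_of_all _ fun _ ↦ gaussianPDF_lt_top)]
    simp only [toReal_gaussianPDF, smul_eq_mul, hpt]
    exact (integrable_exp_neg_mul_sq (half_pos hx')).const_mul _
  · rw [integral_gaussianReal_eq_integral_smul one_ne_zero]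
    simp only [smul_eq_mul, hpt]
    rw [integral_const_mul, integral_gaussian, ← Real.sqrt_inv, ← Real.sqrt_mul (by positivity)]
    have h1 : (2 * Real.pi)⁻¹ * (Real.pi / ((1 - x) / 2)) = x / (1 - x) + 1 := by
      field_simp
      ring
    have h2 : Real.exp (x / (2 * (1 - x))) = √(Real.exp (x / (1 - x))) := by
      rw [Real.sqrt_eq_rpow, ← Real.exp_mul]
      congr 1
      field_simp
    rw [h1, h2]
    exact Real.sqrt_le_sqrt (Real.add_one_le_exp _)

theorem integral_exp_sum_sq_pi_gaussianReal_le {ι : Type*} [Fintype ι] {ρ : ι → ℝ}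
    (hρ : ∀ k, ρ k < 1) :
    Integrable (fun w : ι → ℝ ↦ Real.exp (∑ k, ρ k / 2 * w k ^ 2))
        (Measure.pi fun _ : ι ↦ gaussianReal 0 1) ∧
      ∫ w, Real.exp (∑ k, ρ k / 2 * w k ^ 2) ∂(Measure.pi fun _ : ι ↦ gaussianReal 0 1)
        ≤ Real.exp (∑ k, ρ k / (2 * (1 - ρ k))) := by
  simp only [Real.exp_sum]
  refine ⟨Integrable.fintype_prod (f := fun k y ↦ Real.exp (ρ k / 2 * y ^ 2))
    fun k ↦ (integral_exp_sq_gaussianReal_le (hρ k)).1, ?_⟩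
  rw [integral_fintype_prod_eq_prod (fun k y ↦ Real.exp (ρ k / 2 * y ^ 2))]
  exact Finset.prod_le_prod (fun k _ ↦ integral_nonneg fun y ↦ (Real.exp_pos _).le)
    fun k _ ↦ (integral_exp_sq_gaussianReal_le (hρ k)).2

theorem mul_sqrt_le_sq_add {l a x : ℝ} (hx : 0 < x) (ha : 0 ≤ a) :
    l * √a ≤ x / 2 * a + l ^ 2 / (2 * x) := by
  have h : x / 2 * a + l ^ 2 / (2 * x) - l * √a = (x * √a - l) ^ 2 / (2 * x) := by
    have := Real.sq_sqrt ha
    field_simp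
    linear_combination (-x ^ 2) * this
  have : 0 ≤ (x * √a - l) ^ 2 / (2 * x) := by positivity
  linarith

section Chevet

variable {m k : Type*} [Fintype m] [Fintype k]

/-- Joint exponential moment of the norms of two independent standard Gaussian vectors. -/
theorem integral_exp_norm_add_norm_le [Nonempty m] [Nonempty k] {l : ℝ} (hl : 0 < l) :
    Integrable (fun w : (m × k) ⊕ Unit ⊕ m ⊕ k → ℝ ↦
        Real.exp (l * (√(∑ i, w (.inr (.inr (.inl i))) ^ 2)
          + √(∑ j, w (.inr (.inr (.inr j))) ^ 2))))
        (Measure.pi fun _ ↦ gaussianReal 0 1) ∧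
      ∫ w : (m × k) ⊕ Unit ⊕ m ⊕ k → ℝ, Real.exp (l * (√(∑ i, w (.inr (.inr (.inl i))) ^ 2)
          + √(∑ j, w (.inr (.inr (.inr j))) ^ 2))) ∂(Measure.pi fun _ ↦ gaussianReal 0 1)
        ≤ Real.exp (l * (√(Fintype.card m) + √(Fintype.card k)) + l ^ 2) := by
  have hm : 0 < √(Fintype.card m : ℝ) := Real.sqrt_pos.2 (by exact_mod_cast Fintype.card_pos)
  have hk : 0 < √(Fintype.card k : ℝ) := Real.sqrt_pos.2 (by exact_mod_cast Fintype.card_pos)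
  have hm2 := Real.sq_sqrt (Nat.cast_nonneg (α := ℝ) (Fintype.card m))
  have hk2 := Real.sq_sqrt (Nat.cast_nonneg (α := ℝ) (Fintype.card k))
  set M := √(Fintype.card m : ℝ)
  set K := √(Fintype.card k : ℝ)
  set x := l / (l + M) with hx
  set y := l / (l + K) with hy
  have hx0 : 0 < x := by positivity
  have hy0 : 0 < y := by positivity
  have hx1 : x < 1 := by rw [hx, div_lt_one (by positivity)]; linarith
  have hy1 : y < 1 := by rw [hy, div_lt_one (by positivity)]; linarith
  set ρ : (m × k) ⊕ Unit ⊕ m ⊕ k → ℝ :=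
    Sum.elim (fun _ ↦ 0) (Sum.elim (fun _ ↦ 0) (Sum.elim (fun _ ↦ x) fun _ ↦ y)) with hρ
  have hρ1 : ∀ i, ρ i < 1 := by
    rintro (_ | _ | _ | _) <;> simp [hρ, hx1, hy1]
  obtain ⟨hintegrable, hle⟩ := integral_exp_sum_sq_pi_gaussianReal_le hρ1
  have hpt (w : (m × k) ⊕ Unit ⊕ m ⊕ k → ℝ) :
      Real.exp (l * (√(∑ i, w (.inr (.inr (.inl i))) ^ 2)
          + √(∑ j, w (.inr (.inr (.inr j))) ^ 2)))
        ≤ Real.exp (l ^ 2 / (2 * x) + l ^ 2 / (2 * y)) * Real.exp (∑ i, ρ i / 2 * w i ^ 2) := by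
    rw [← Real.exp_add, Real.exp_le_exp]
    simp only [hρ, Fintype.sum_sum_type, Sum.elim_inl, Sum.elim_inr, zero_div, zero_mul,
      Finset.sum_const_zero, zero_add, ← Finset.mul_sum]
    have h1 := mul_sqrt_le_sq_add (l := l) hx0
      (Finset.sum_nonneg fun i _ ↦ sq_nonneg (w (.inr (.inr (.inl i)))) :
        0 ≤ ∑ i, w (.inr (.inr (.inl i))) ^ 2)
    have h2 := mul_sqrt_le_sq_add (l := l) hy0
      (Finset.sum_nonneg fun j _ ↦ sq_nonneg (w (.inr (.inr (.inr j)))) :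
        0 ≤ ∑ j, w (.inr (.inr (.inr j))) ^ 2)
    linarith
  have hintegrable' : Integrable (fun w : (m × k) ⊕ Unit ⊕ m ⊕ k → ℝ ↦
      Real.exp (l * (√(∑ i, w (.inr (.inr (.inl i))) ^ 2)
        + √(∑ j, w (.inr (.inr (.inr j))) ^ 2)))) (Measure.pi fun _ ↦ gaussianReal 0 1) := by
    refine (hintegrable.const_mul (Real.exp (l ^ 2 / (2 * x) + l ^ 2 / (2 * y)))).mono'
      (Measurable.aestronglyMeasurable (by fun_prop))
      (ae_of_all _ fun w ↦ ?_)
    rw [Real.norm_eq_abs, abs_of_nonneg (Real.exp_pos _).le]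
    exact hpt w
  refine ⟨hintegrable', (integral_mono hintegrable' (hintegrable.const_mul _) hpt).trans ?_⟩
  rw [integral_const_mul]
  refine (mul_le_mul_of_nonneg_left hle (Real.exp_pos _).le).trans (le_of_eq ?_)
  rw [← Real.exp_add]
  congr 1
  simp only [hρ, Fintype.sum_sum_type, Sum.elim_inl, Sum.elim_inr, zero_div,
      Finset.sum_const_zero, zero_add, Finset.sum_const, Finset.card_univ, nsmul_eq_mul]
  rw [← hm2, ← hk2, hx, hy]
  have h1 : 1 - l / (l + M) = M / (l + M) := by field_simp; ring
  have h2 : 1 - l / (l + K) = K / (l + K) := by field_simp; ring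
  rw [h1, h2]
  field_simp
  ring

theorem one_sub_exp_neg_le_exp {S q p : ℝ} (hS : S ≤ Real.exp q) (hp0 : 0 ≤ p) (hp1 : p ≤ 1) :
    1 - Real.exp (-S) ≤ Real.exp (p * q) := by
  rcases le_total 0 q with hq | hq
  · have := Real.one_le_exp (mul_nonneg hp0 hq)
    linarith [Real.exp_pos (-S)]
  · have h1 : Real.exp q ≤ Real.exp (p * q) := Real.exp_le_exp.2 (by nlinarith)
    linarith [Real.add_one_le_exp (-S)]

theorem sum_mul_le_sqrt_s9 {u x : m → ℝ} (hu : ∑ i, u i ^ 2 = 1) :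
    ∑ i, u i * x i ≤ √(∑ i, x i ^ 2) := by
  refine Real.le_sqrt_of_sq_le ?_
  simpa [hu] using Finset.sum_mul_sq_le_sq_mul_sq Finset.univ u x

theorem sum_mul_le_one_s9 {u x : m → ℝ} (hu : ∑ i, u i ^ 2 = 1) (hx : ∑ i, x i ^ 2 = 1) :
    ∑ i, u i * x i ≤ 1 := by
  simpa [hx] using sum_mul_le_sqrt_s9 (x := x) hu

/-- Upper tail of finitely many bilinear forms `uᵀ G v` in a standard Gaussian matrix `G`. -/
theorem measureReal_exists_bilin_gt_le {I : Type*} [Fintype I] [Nonempty I]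
    [Nonempty m] [Nonempty k] (u : I → m → ℝ) (v : I → k → ℝ)
    (hu : ∀ i, ∑ p, u i p ^ 2 = 1) (hv : ∀ i, ∑ q, v i q ^ 2 = 1) {t : ℝ} (ht : 5 ≤ t) :
    (Measure.pi fun _ : (m × k) ⊕ Unit ⊕ m ⊕ k ↦ gaussianReal 0 1).real
        {w | ∃ i, √(Fintype.card m) + √(Fintype.card k) + t
          < ∑ p : m × k, u i p.1 * v i p.2 * w (.inl p)}
      ≤ 3 * Real.exp (-t ^ 2 / 8) := by
  set γ := Measure.pi fun _ : (m × k) ⊕ Unit ⊕ m ⊕ k ↦ gaussianReal 0 1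
  set s := √(Fintype.card m : ℝ) + √(Fintype.card k : ℝ) + t with hs
  set N := (Fintype.card I : ℝ)
  have hN : 1 ≤ N := Nat.one_le_cast.2 Fintype.card_pos
  have hlog : 0 ≤ Real.log N := Real.log_nonneg hN
  have hl : 0 < t / 2 := by linarith
  set β := t / 2 * (1 + Real.log N) with hβ
  have hβ0 : 0 < β := by positivity
  set b : I → (m × k) ⊕ Unit ⊕ m ⊕ k → ℝ := fun i ↦
    Sum.elim (fun _ ↦ 0) (Sum.elim (fun _ ↦ 0)
      (Sum.elim (fun p ↦ β * u i p) fun q ↦ β * v i q)) with hb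
  set a : ℝ → I → (m × k) ⊕ Unit ⊕ m ⊕ k → ℝ := fun ε i ↦
    Sum.elim (fun p ↦ β * (u i p.1 * v i p.2)) (Sum.elim (fun _ ↦ β * ε)
      (Sum.elim (fun _ ↦ 0) fun _ ↦ 0)) with ha
  set E : (I → (m × k) ⊕ Unit ⊕ m ⊕ k → ℝ) → ((m × k) ⊕ Unit ⊕ m ⊕ k → ℝ) → ℝ :=
    fun A w ↦ Real.exp (-∑ i, Real.exp (A i ⬝ᵥ w + -(β * s))) with hE
  have hEm (A) : Measurable (E A) := by
    simp only [hE, dotProduct]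
    fun_prop
  have hEi (A) : Integrable (E A) γ := by
    refine .of_bound (hEm A).aestronglyMeasurable 1 (ae_of_all _ fun w ↦ ?_)
    rw [Real.norm_eq_abs, abs_of_nonneg (Real.exp_pos _).le, Real.exp_le_one_iff, neg_nonpos]
    positivity
  have hE1 (A) (w) : 0 ≤ 1 - E A w := by
    rw [sub_nonneg, Real.exp_le_one_iff, neg_nonpos]
    positivity
  have hprod (i j : I) : ∑ p : m × k, u i p.1 * v i p.2 * (u j p.1 * v j p.2)
      = (∑ p, u i p * u j p) * ∑ q, v i q * v j q := by
    rw [Fintype.sum_prod_type, Finset.sum_mul_sum]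
    exact Finset.sum_congr rfl fun p _ ↦ Finset.sum_congr rfl fun q _ ↦ by ring
  have haa (ε : ℝ) (i j : I) : a ε i ⬝ᵥ a ε j
      = β ^ 2 * ((∑ p, u i p * u j p) * (∑ q, v i q * v j q) + ε ^ 2) := by
    rw [← hprod]
    simp only [ha, dotProduct, Fintype.sum_sum_type, Sum.elim_inl, Sum.elim_inr, mul_add,
      Finset.mul_sum, mul_zero, Finset.sum_const_zero, add_zero, Finset.univ_unique,
      Finset.sum_singleton]
    congr 1
    · exact Finset.sum_congr rfl fun p _ ↦ by ring
    · ring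
  have hbb (i j : I) : b i ⬝ᵥ b j
      = β ^ 2 * ((∑ p, u i p * u j p) + ∑ q, v i q * v j q) := by
    simp only [hb, dotProduct, Fintype.sum_sum_type, Sum.elim_inl, Sum.elim_inr, mul_add,
      Finset.mul_sum, mul_zero, Finset.sum_const_zero, zero_add]
    congr 1 <;> exact Finset.sum_congr rfl fun p _ ↦ by ring
  have hcomp (ε : ℝ) (hε : ε ^ 2 = 1) : ∫ w, E b w ∂γ ≤ ∫ w, E (a ε) w ∂γ := by
    refine integral_exp_neg_sum_exp_le (a ε) b (fun _ ↦ -(β * s)) (fun i j ↦ ?_) (fun i ↦ ?_)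
      fun i j ↦ ?_
    · simp [ha, hb, dotProduct]
    · rw [haa, hbb, hε]
      simp only [← sq, hu, hv]
      norm_num
    · rw [haa, hbb, hε]
      refine mul_le_mul_of_nonneg_left ?_ (sq_nonneg β)
      nlinarith [sum_mul_le_one_s9 (hu i) (hu j), sum_mul_le_one_s9 (hv i) (hv j)]
  have hbw (i : I) (w) : b i ⬝ᵥ w ≤ β * (√(∑ i, w (.inr (.inr (.inl i))) ^ 2)
      + √(∑ j, w (.inr (.inr (.inr j))) ^ 2)) := by
    simp only [hb, dotProduct, Fintype.sum_sum_type, Sum.elim_inl, Sum.elim_inr, zero_mul,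
      Finset.sum_const_zero, zero_add, mul_assoc, ← Finset.mul_sum, ← mul_add]
    exact mul_le_mul_of_nonneg_left
      (add_le_add (sum_mul_le_sqrt_s9 (hu i)) (sum_mul_le_sqrt_s9 (hv i))) hβ0.le
  have hEb (w) : 1 - E b w ≤ Real.exp (1 - t / 2 * s) *
      Real.exp (t / 2 * (√(∑ i, w (.inr (.inr (.inl i))) ^ 2)
      + √(∑ j, w (.inr (.inr (.inr j))) ^ 2))) := by
    set R := √(∑ i, w (.inr (.inr (.inl i))) ^ 2) + √(∑ j, w (.inr (.inr (.inr j))) ^ 2)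
    have hS : ∑ i, Real.exp (b i ⬝ᵥ w + -(β * s)) ≤ Real.exp (Real.log N + β * (R - s)) := by
      rw [Real.exp_add, Real.exp_log (by linarith)]
      refine (Finset.sum_le_card_nsmul Finset.univ _ (Real.exp (β * (R - s)))
        fun i _ ↦ Real.exp_le_exp.2 (by linarith [hbw i w])).trans_eq ?_
      rw [nsmul_eq_mul, Finset.card_univ]
    refine (one_sub_exp_neg_le_exp hS (p := (1 + Real.log N)⁻¹) (by positivity)
      (inv_le_one_of_one_le₀ (by linarith))).trans ?_
    rw [← Real.exp_add, Real.exp_le_exp]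
    have h1 : (1 + Real.log N)⁻¹ * (Real.log N + β * (R - s))
        = (1 + Real.log N)⁻¹ * Real.log N + t / 2 * (R - s) := by
      rw [hβ]; field_simp
    have h2 : (1 + Real.log N)⁻¹ * Real.log N ≤ 1 := by
      rw [inv_mul_le_iff₀ (by linarith)]; linarith
    rw [h1]
    linarith
  have hbound : ∫ w, (1 - E b w) ∂γ ≤ Real.exp (1 - t ^ 2 / 4) := by
    obtain ⟨hi, hle⟩ := integral_exp_norm_add_norm_le (m := m) (k := k) hl
    refine (integral_mono ((integrable_const 1).sub (hEi b)) (hi.const_mul _) hEb).trans ?_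
    rw [integral_const_mul]
    refine (mul_le_mul_of_nonneg_left hle (Real.exp_pos _).le).trans_eq ?_
    rw [← Real.exp_add, hs]
    congr 1
    ring
  have hmarkov (ε : ℝ) (hε : ε ^ 2 = 1) :
      (1 - Real.exp (-1)) * γ.real {w | 1 - Real.exp (-1) ≤ 1 - E (a ε) w}
        ≤ Real.exp (1 - t ^ 2 / 4) := by
    refine (mul_meas_ge_le_integral_of_nonneg (ae_of_all _ (hE1 (a ε)))
      ((integrable_const 1).sub (hEi (a ε))) _).trans (le_trans ?_ hbound)
    rw [integral_sub (integrable_const 1) (hEi _), integral_sub (integrable_const 1) (hEi _)]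
    exact sub_le_sub_left (hcomp ε hε) _
  have hsub : {w | ∃ i, s < ∑ p : m × k, u i p.1 * v i p.2 * w (.inl p)}
      ⊆ {w | 1 - Real.exp (-1) ≤ 1 - E (a 1) w} ∪ {w | 1 - Real.exp (-1) ≤ 1 - E (a (-1)) w} := by
    rintro w ⟨i, hi⟩
    have key (ε : ℝ) (hz : 0 ≤ ε * w (.inr (.inl ()))) :
        1 - Real.exp (-1) ≤ 1 - E (a ε) w := by
      have h1 : 0 ≤ a ε i ⬝ᵥ w + -(β * s) := by
        have : a ε i ⬝ᵥ w = β * ∑ p : m × k, u i p.1 * v i p.2 * w (.inl p)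
            + β * (ε * w (.inr (.inl ()))) := by
          simp only [ha, dotProduct, Fintype.sum_sum_type, Sum.elim_inl, Sum.elim_inr, zero_mul,
            Finset.sum_const_zero, add_zero, mul_assoc, ← Finset.mul_sum, Finset.univ_unique,
            Finset.sum_singleton]
        rw [this]
        nlinarith [mul_nonneg hβ0.le hz]
      have h2 : 1 ≤ ∑ i, Real.exp (a ε i ⬝ᵥ w + -(β * s)) :=
        (Real.one_le_exp h1).trans (Finset.single_le_sum
          (f := fun i ↦ Real.exp (a ε i ⬝ᵥ w + -(β * s)))
          (fun j _ ↦ (Real.exp_pos _).le) (Finset.mem_univ i))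
      exact sub_le_sub_left (Real.exp_le_exp.2 (neg_le_neg h2)) _
    rcases le_total 0 (w (.inr (.inl ()))) with hz | hz
    · exact .inl (key 1 (by linarith))
    · exact .inr (key (-1) (by linarith))
  have hun := (measureReal_mono hsub).trans (measureReal_union_le (μ := γ) _ _)
  have h1 := hmarkov 1 (by norm_num)
  have h2 := hmarkov (-1) (by norm_num)
  have he : Real.exp (-1) ≤ 1 / 2 := by
    rw [Real.exp_neg, one_div]
    exact inv_anti₀ (by norm_num) (by linarith [Real.add_one_le_exp 1])
  have hsplit : Real.exp (1 - t ^ 2 / 4)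
      = Real.exp (1 + -t ^ 2 / 8) * Real.exp (-t ^ 2 / 8) := by
    rw [← Real.exp_add]; congr 1; ring
  have hsmall : Real.exp (1 + -t ^ 2 / 8) ≤ 1 / 2 :=
    (Real.exp_le_exp.2 (by nlinarith)).trans he
  have hpos := Real.exp_pos (-t ^ 2 / 8)
  have hr (A : Set _) : 0 ≤ γ.real A := measureReal_nonneg
  nlinarith [hr {w | 1 - Real.exp (-1) ≤ 1 - E (a 1) w},
    hr {w | 1 - Real.exp (-1) ≤ 1 - E (a (-1)) w}]

end Chevet

theorem measurePreserving_curry_pi {m k : Type*} [Fintype m] [Fintype k] (ν : m → k → Measure ℝ)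
    [∀ i j, IsProbabilityMeasure (ν i j)] :
    MeasurePreserving (MeasurableEquiv.curry m k ℝ) (Measure.pi fun p : m × k ↦ ν p.1 p.2)
      (Measure.pi fun i ↦ Measure.pi fun j ↦ ν i j) := by
  refine ⟨MeasurableEquiv.measurable _, ?_⟩
  have h := Measure.infinitePi_map_curry ν
  simpa only [Measure.infinitePi_eq_pi] using h

theorem sum_sub_mean_sq_le {n : ℕ} (y : Fin n → ℝ) :
    ∑ i, (y i - (n : ℝ)⁻¹ * ∑ l, y l) ^ 2 ≤ ∑ i, y i ^ 2 := by
  rcases Nat.eq_zero_or_pos n with rfl | hn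
  · simp
  have hn' : (n : ℝ) ≠ 0 := by positivity
  have h : ∑ i, (y i - (n : ℝ)⁻¹ * ∑ l, y l) ^ 2
      = ∑ i, y i ^ 2 - (n : ℝ)⁻¹ * (∑ l, y l) ^ 2 := by
    simp only [sub_sq, Finset.sum_add_distrib, Finset.sum_sub_distrib, ← Finset.sum_mul,
      ← Finset.mul_sum, Finset.sum_const, Finset.card_univ, Fintype.card_fin, nsmul_eq_mul]
    field_simp
    ring
  rw [h]
  exact sub_le_self _ (by positivity)

/-- The spectral norm of the sample covariance is controlled by that of the data matrix centred
at any fixed point. -/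
theorem norm_sample_covariance_le {d n : ℕ} (X : Fin n → Fin d → ℝ) (μ : Fin d → ℝ) {s : ℝ}
    (hs : 0 ≤ s) (hX : ∀ x : EuclideanSpace ℝ (Fin d),
      ∑ i, (∑ j, (X i j - μ j) * x j) ^ 2 ≤ (s * ‖x‖) ^ 2) :
    ‖Matrix.toEuclideanCLM (𝕜 := ℝ)
        (Matrix.of fun j k : Fin d =>
          (n : ℝ)⁻¹ * ∑ i, (X i j - (n : ℝ)⁻¹ * ∑ i', X i' j)
            * (X i k - (n : ℝ)⁻¹ * ∑ i', X i' k))‖ ≤ (n : ℝ)⁻¹ * s ^ 2 := by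
  rcases Nat.eq_zero_or_pos n with rfl | hn
  · simp only [CharP.cast_eq_zero, inv_zero, zero_mul]
    refine le_of_eq (norm_eq_zero.2 ?_)
    exact map_zero _
  have hn' : (n : ℝ) ≠ 0 := by positivity
  set A := Matrix.of fun j k : Fin d =>
          (n : ℝ)⁻¹ * ∑ i, (X i j - (n : ℝ)⁻¹ * ∑ i', X i' j)
            * (X i k - (n : ℝ)⁻¹ * ∑ i', X i' k) with hA
  set c : EuclideanSpace ℝ (Fin d) → Fin n → ℝ :=
    fun x i ↦ ∑ j, (X i j - (n : ℝ)⁻¹ * ∑ i', X i' j) * x j with hc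
  have hcs (x : EuclideanSpace ℝ (Fin d)) : ∑ i, c x i ^ 2 ≤ (s * ‖x‖) ^ 2 := by
    refine le_trans (le_of_eq ?_) ((sum_sub_mean_sq_le fun i ↦ ∑ j, (X i j - μ j) * x j).trans
      (hX x))
    refine Finset.sum_congr rfl fun i _ ↦ ?_
    congr 1
    rw [Finset.sum_comm, Finset.mul_sum, ← Finset.sum_sub_distrib]
    refine Finset.sum_congr rfl fun j _ ↦ ?_
    rw [← Finset.sum_mul, Finset.sum_sub_distrib]
    simp only [Finset.sum_const, Finset.card_univ, Fintype.card_fin, nsmul_eq_mul]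
    field_simp
    ring
  have hinner (x y : EuclideanSpace ℝ (Fin d)) :
      inner ℝ y (Matrix.toEuclideanCLM (𝕜 := ℝ) A x) = (n : ℝ)⁻¹ * ∑ i, c y i * c x i := by
    rw [Matrix.inner_toEuclideanCLM]
    obtain ⟨z, hz⟩ : ∃ z : Fin n → Fin d → ℝ,
      ∀ i j, X i j - (n : ℝ)⁻¹ * ∑ i', X i' j = z i j := ⟨_, fun _ _ ↦ rfl⟩
    simp only [dotProduct, Matrix.mulVec, hA, hc, Matrix.of_apply, hz]
    simp only [Finset.sum_mul_sum]
    rw [Finset.sum_comm, Finset.mul_sum]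
    refine Finset.sum_congr rfl fun j _ ↦ ?_
    rw [Finset.sum_comm, Finset.mul_sum, Finset.mul_sum]
    refine Finset.sum_congr rfl fun l _ ↦ ?_
    simp only [Finset.mul_sum, Finset.sum_mul]
    exact Finset.sum_congr rfl fun i _ ↦ by ring
  refine ContinuousLinearMap.opNorm_le_bound _ (by positivity) fun x ↦ ?_
  set y := Matrix.toEuclideanCLM (𝕜 := ℝ) A x with hy
  rcases (norm_nonneg y).eq_or_lt with h0 | h0
  · rw [← h0]; positivity
  have h1 : ‖y‖ ^ 2 = (n : ℝ)⁻¹ * ∑ i, c y i * c x i := by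
    rw [← hinner, ← hy, real_inner_self_eq_norm_sq]
  have h2 : ∑ i, c y i * c x i ≤ (s * ‖y‖) * (s * ‖x‖) := by
    refine le_of_sq_le_sq ?_ (by positivity)
    refine (Finset.sum_mul_sq_le_sq_mul_sq _ _ _).trans ?_
    rw [mul_pow]
    exact mul_le_mul (hcs y) (hcs x) (Finset.sum_nonneg fun i _ ↦ sq_nonneg _) (sq_nonneg _)
  have h3 : ‖y‖ * ‖y‖ ≤ ‖y‖ * ((n : ℝ)⁻¹ * s ^ 2 * ‖x‖) := by
    rw [← sq, h1]
    refine (mul_le_mul_of_nonneg_left h2 (by positivity)).trans_eq (by ring)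
  exact le_of_mul_le_mul_left h3 h0

theorem sum_mulVec_sq_le_of_bilin_le {m k : Type*} [Fintype m] [Fintype k] (G : m → k → ℝ) {s : ℝ}
    (hs : 0 ≤ s)
    (hG : ∀ (u : Metric.sphere (0 : EuclideanSpace ℝ m) 1)
      (v : Metric.sphere (0 : EuclideanSpace ℝ k) 1),
      ∑ p : m × k, u.1 p.1 * v.1 p.2 * G p.1 p.2 ≤ s) (x : EuclideanSpace ℝ k) :
    ∑ i, (∑ j, G i j * x j) ^ 2 ≤ (s * ‖x‖) ^ 2 := by
  set y : EuclideanSpace ℝ m := WithLp.toLp 2 fun i ↦ ∑ j, G i j * x j with hy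
  have hyn : ∑ i, (∑ j, G i j * x j) ^ 2 = ‖y‖ ^ 2 := by
    rw [EuclideanSpace.real_norm_sq_eq]
  rw [hyn]
  refine pow_le_pow_left₀ (norm_nonneg _) ?_ 2
  rcases (norm_nonneg y).eq_or_lt with h0 | h0
  · rw [← h0]; positivity
  have hx0 : 0 < ‖x‖ := by
    refine norm_pos_iff.2 fun hx ↦ h0.ne' ?_
    rw [norm_eq_zero]
    ext i
    simp [hy, hx]
  have h := hG ⟨‖y‖⁻¹ • y, by simp [norm_smul, h0.ne']⟩ ⟨‖x‖⁻¹ • x, by simp [norm_smul, hx0.ne']⟩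
  have hsum : ∑ p : m × k, (‖y‖⁻¹ • y) p.1 * (‖x‖⁻¹ • x) p.2 * G p.1 p.2 = ‖y‖ * ‖x‖⁻¹ := by
    have : ∑ p : m × k, (‖y‖⁻¹ • y) p.1 * (‖x‖⁻¹ • x) p.2 * G p.1 p.2
        = ‖y‖⁻¹ * ‖x‖⁻¹ * ∑ i, y i * ∑ j, G i j * x j := by
      rw [Fintype.sum_prod_type, Finset.mul_sum]
      refine Finset.sum_congr rfl fun i _ ↦ ?_
      rw [Finset.mul_sum, Finset.mul_sum]
      refine Finset.sum_congr rfl fun j _ ↦ ?_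
      simp only [PiLp.smul_apply, smul_eq_mul]
      ring
    rw [this]
    have h2 : ∑ i, y i * ∑ j, G i j * x j = ‖y‖ ^ 2 := by
      rw [← hyn]
      exact Finset.sum_congr rfl fun i _ ↦ by rw [sq]
    rw [h2]
    field_simp
  rw [hsum, ← div_eq_mul_inv, div_le_iff₀ hx0] at h
  exact h

theorem sum_sq_of_mem_sphere {m : Type*} [Fintype m]
    (x : Metric.sphere (0 : EuclideanSpace ℝ m) 1) : ∑ i, x.1 i ^ 2 = 1 := by
  rw [← EuclideanSpace.real_norm_sq_eq, norm_eq_of_mem_sphere, one_pow]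

/-- Upper tail of the operator norm of a standard Gaussian matrix, through its bilinear forms. -/
theorem measure_exists_sphere_bilin_gt_le {m k : Type*} [Fintype m] [Fintype k]
    [Nonempty m] [Nonempty k] {t : ℝ} (ht : 5 ≤ t) :
    (Measure.pi fun _ : (m × k) ⊕ Unit ⊕ m ⊕ k ↦ gaussianReal 0 1)
        {w | ∃ (u : Metric.sphere (0 : EuclideanSpace ℝ m) 1)
          (v : Metric.sphere (0 : EuclideanSpace ℝ k) 1),
          √(Fintype.card m) + √(Fintype.card k) + t
            < ∑ p : m × k, u.1 p.1 * v.1 p.2 * w (.inl p)}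
      ≤ ENNReal.ofReal (3 * Real.exp (-t ^ 2 / 8)) := by
  set γ := Measure.pi fun _ : (m × k) ⊕ Unit ⊕ m ⊕ k ↦ gaussianReal 0 1
  set s := √(Fintype.card m : ℝ) + √(Fintype.card k : ℝ) + t
  have : Nonempty (Metric.sphere (0 : EuclideanSpace ℝ m) 1) :=
    (NormedSpace.sphere_nonempty.2 zero_le_one).to_subtype
  have : Nonempty (Metric.sphere (0 : EuclideanSpace ℝ k) 1) :=
    (NormedSpace.sphere_nonempty.2 zero_le_one).to_subtype
  set e := TopologicalSpace.denseSeq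
    (Metric.sphere (0 : EuclideanSpace ℝ m) 1 × Metric.sphere (0 : EuclideanSpace ℝ k) 1)
  set B : ℕ → Set ((m × k) ⊕ Unit ⊕ m ⊕ k → ℝ) := fun N ↦
    {w | ∃ i : Fin (N + 1), s < ∑ p : m × k, (e i).1.1 p.1 * (e i).2.1 p.2 * w (.inl p)} with hB
  have hsub : {w | ∃ (u : Metric.sphere (0 : EuclideanSpace ℝ m) 1)
          (v : Metric.sphere (0 : EuclideanSpace ℝ k) 1),
          s < ∑ p : m × k, u.1 p.1 * v.1 p.2 * w (.inl p)} ⊆ ⋃ N, B N := by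
    rintro w ⟨u, v, huv⟩
    have hopen : IsOpen {q : Metric.sphere (0 : EuclideanSpace ℝ m) 1 ×
        Metric.sphere (0 : EuclideanSpace ℝ k) 1 | s <
        ∑ p : m × k, q.1.1 p.1 * q.2.1 p.2 * w (.inl p)} :=
      isOpen_lt continuous_const (by fun_prop)
    obtain ⟨i, hi⟩ := (TopologicalSpace.denseRange_denseSeq _).exists_mem_open hopen ⟨(u, v), huv⟩
    exact Set.mem_iUnion.2 ⟨i, ⟨i, i.lt_succ_self⟩, hi⟩
  have hmono : Monotone B := by
    rintro N N' hN w ⟨i, hi⟩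
    exact ⟨⟨i, i.2.trans_le (by omega)⟩, hi⟩
  refine (measure_mono hsub).trans ?_
  rw [hmono.measure_iUnion]
  refine iSup_le fun N ↦ ?_
  have h := measureReal_exists_bilin_gt_le (fun i : Fin (N + 1) ↦ ((e i).1.1 : m → ℝ))
    (fun i ↦ ((e i).2.1 : k → ℝ)) (fun i ↦ sum_sq_of_mem_sphere (e i).1) (fun i ↦ sum_sq_of_mem_sphere (e i).2) ht
  exact (ENNReal.le_ofReal_iff_toReal_le (measure_ne_top _ _) (by positivity)).2 h

/-- Let `X` be an `n × d` matrix with rows i.i.d. from `N(μ, I_d)`, `μ̄` the sample mean of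
the rows, and `Σ = (1/n)(X - μ̄)ᵀ(X - μ̄)`.  If `d/n ≤ 16`, `n ≥ 16` and `t ≥ 5`, then with
probability at least `1 - 3 exp(-t²/8)`, `‖Σ‖₂ ≤ (1 + √(d/n) + t/√n)²`. -/
theorem sample_covariance_spectral_norm_bound_simplified (d n : ℕ)
    (μ : Fin d → ℝ) (t : ℝ) (hdn : (d : ℝ) / n ≤ 16) (hn : 16 ≤ n) (ht : 5 ≤ t) :
    ENNReal.ofReal (1 - 3 * Real.exp (-t ^ 2 / 8)) ≤
      (Measure.pi fun _ : Fin n => Measure.pi fun j : Fin d => gaussianReal (μ j) 1)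
        {X | ‖Matrix.toEuclideanCLM (𝕜 := ℝ)
            (Matrix.of fun j k : Fin d =>
              (n : ℝ)⁻¹ * ∑ i, (X i j - (n : ℝ)⁻¹ * ∑ i', X i' j)
                * (X i k - (n : ℝ)⁻¹ * ∑ i', X i' k))‖
          ≤ (1 + Real.sqrt ((d : ℝ) / n) + t / Real.sqrt n) ^ 2} := by
  have hn0 : (0 : ℝ) < n := by exact_mod_cast (by omega : 0 < n)
  set s := √(n : ℝ) + √(d : ℝ) + t with hs
  have hs0 : 0 ≤ s := by positivity
  have hrhs : (1 + Real.sqrt ((d : ℝ) / n) + t / Real.sqrt n) ^ 2 = (n : ℝ)⁻¹ * s ^ 2 := by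
    have h1 : 1 + Real.sqrt ((d : ℝ) / n) + t / Real.sqrt n = s / √(n : ℝ) := by
      rw [Real.sqrt_div (Nat.cast_nonneg d), hs]
      field_simp
    rw [h1, div_pow, Real.sq_sqrt hn0.le]
    ring
  rw [hrhs]
  rcases Nat.eq_zero_or_pos d with rfl | hd
  · have huniv : {X : Fin n → Fin 0 → ℝ | ‖Matrix.toEuclideanCLM (𝕜 := ℝ)
            (Matrix.of fun j k : Fin 0 =>
              (n : ℝ)⁻¹ * ∑ i, (X i j - (n : ℝ)⁻¹ * ∑ i', X i' j)
                * (X i k - (n : ℝ)⁻¹ * ∑ i', X i' k))‖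
          ≤ (n : ℝ)⁻¹ * s ^ 2} = Set.univ := by
      refine Set.eq_univ_of_forall fun X ↦ norm_sample_covariance_le X μ hs0 fun x ↦ ?_
      simp
      positivity
    rw [huniv, measure_univ]
    refine ENNReal.ofReal_le_one.2 ?_
    linarith [Real.exp_pos (-t ^ 2 / 8)]
  have : Nonempty (Fin n) := ⟨⟨0, by omega⟩⟩
  have : Nonempty (Fin d) := ⟨⟨0, hd⟩⟩
  have hfst : MeasurePreserving
      (fun (w : (Fin n × Fin d) ⊕ Unit ⊕ Fin n ⊕ Fin d → ℝ) p ↦ w (.inl p))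
      (Measure.pi fun _ ↦ gaussianReal 0 1) (Measure.pi fun _ ↦ gaussianReal 0 1) :=
    measurePreserving_fst.comp (measurePreserving_sumPiEquivProdPi
      fun _ : (Fin n × Fin d) ⊕ Unit ⊕ Fin n ⊕ Fin d ↦ gaussianReal 0 1)
  have hshift : MeasurePreserving (fun (G : Fin n → Fin d → ℝ) i j ↦ G i j + μ j)
      (Measure.pi fun _ ↦ Measure.pi fun _ ↦ gaussianReal 0 1)
      (Measure.pi fun _ ↦ Measure.pi fun j ↦ gaussianReal (μ j) 1) :=
    measurePreserving_pi (fun _ ↦ Measure.pi fun _ ↦ gaussianReal 0 1) _ fun _ ↦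
      measurePreserving_pi (fun _ ↦ gaussianReal 0 1) (fun j ↦ gaussianReal (μ j) 1)
        (f := fun j y ↦ y + μ j) fun j ↦
          ⟨by fun_prop, by rw [gaussianReal_map_add_const, zero_add]⟩
  have hφ := (hshift.comp (measurePreserving_curry_pi fun _ _ ↦ gaussianReal 0 1)).comp hfst
  rw [← hφ.map_eq]
  refine le_trans ?_ (Measure.le_map_apply hφ.measurable.aemeasurable _)
  set γ := Measure.pi fun _ : (Fin n × Fin d) ⊕ Unit ⊕ Fin n ⊕ Fin d ↦ gaussianReal 0 1
  set B := {w : (Fin n × Fin d) ⊕ Unit ⊕ Fin n ⊕ Fin d → ℝ |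
    ∃ (u : Metric.sphere (0 : EuclideanSpace ℝ (Fin n)) 1)
      (v : Metric.sphere (0 : EuclideanSpace ℝ (Fin d)) 1),
      s < ∑ p : Fin n × Fin d, u.1 p.1 * v.1 p.2 * w (.inl p)} with hB
  have hBle : γ B ≤ ENNReal.ofReal (3 * Real.exp (-t ^ 2 / 8)) := by
    simpa [hB, hs] using measure_exists_sphere_bilin_gt_le (m := Fin n) (k := Fin d) ht
  have hcompl : 1 - γ B ≤ γ Bᶜ := by
    rw [tsub_le_iff_left, ← measure_univ (μ := γ), ← Set.union_compl_self B]
    exact measure_union_le _ _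
  rw [ENNReal.ofReal_sub _ (by positivity), ENNReal.ofReal_one]
  refine (tsub_le_tsub_left hBle 1).trans (hcompl.trans (measure_mono fun w hw ↦ ?_))
  refine norm_sample_covariance_le _ μ hs0 fun x ↦ ?_
  have hw' : ∀ (u : Metric.sphere (0 : EuclideanSpace ℝ (Fin n)) 1)
      (v : Metric.sphere (0 : EuclideanSpace ℝ (Fin d)) 1),
      ∑ p : Fin n × Fin d, u.1 p.1 * v.1 p.2 * w (.inl p) ≤ s := by
    simpa [hB] using hw
  have h := sum_mulVec_sq_le_of_bilin_le (fun i j ↦ w (.inl (i, j))) hs0 hw' x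
  simpa [MeasurableEquiv.curry] using h
end
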